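/- Let H be a loopless digraph and G a loopless weakly connected digraph, and let α, β : G → H be homomorphisms. Then there exists a vertex q ∈ V(G) such that the set Π_q of all walks from α(q) to β(q) that are H-realizable for α, β, q is one of the following: (1) Π_q = ∅; (2) Π_q = {Q} for a single reduced walk Q ∈ π(H); (3) Π_q = {RⁿP : n ∈ ℤ} for some R, P ∈ π(H) with R a closed walk at α(q); (4) Π_q contains all reduced walks of even length from α(q) to β(q) that satisfy the zigzag condition for q. -/

import Mathlib

namespace HRecoloring

/-- A digraph: a vertex type together with an arc relation. -/
structure Dgraph (V : Type) where
  Adj : V → V → Prop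

variable {V X : Type}

/-- Adjacency in the underlying undirected graph. -/
def Dgraph.UAdj (G : Dgraph V) (u v : V) : Prop := G.Adj u v ∨ G.Adj v u

/-- A digraph is loopless if it has no arc `v → v`. -/
def Dgraph.Loopless (G : Dgraph V) : Prop := ∀ v, ¬ G.Adj v v

/-- A digraph is reflexive if `v → v` for every vertex `v`. -/
def Dgraph.IsReflexive (G : Dgraph V) : Prop := ∀ v, G.Adj v v

/-- A symmetric digraph, which we identify with an undirected graph. -/
def Dgraph.IsSymmetric (G : Dgraph V) : Prop := ∀ u v, G.Adj u v → G.Adj v u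

/-- The underlying undirected graph, as a symmetric digraph. -/
def Dgraph.usym (G : Dgraph V) : Dgraph V := ⟨fun u v => G.UAdj u v⟩

/-- A (di)graph homomorphism. -/
def IsHom (G : Dgraph V) (H : Dgraph X) (f : V → X) : Prop :=
  ∀ ⦃u v⦄, G.Adj u v → H.Adj (f u) (f v)

/-- A walk from `a` to `b`, encoded by its list of successive vertices.
A walk in a digraph is a walk in its underlying undirected graph. -/
def IsWalk (G : Dgraph V) (a b : V) (l : List V) : Prop :=
  l ≠ [] ∧ l.head? = some a ∧ l.getLast? = some b ∧ l.Chain' G.UAdj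

/-- Weak connectivity. -/
def Dgraph.WConn (G : Dgraph V) : Prop := ∀ u v : V, ∃ l, IsWalk G u v l

/-- Concatenation of two walks sharing an endpoint. -/
def wcomp (l₁ l₂ : List V) : List V := l₁ ++ l₂.tail

/-- Number of edges of a walk. -/
def wlen (l : List V) : ℕ := l.length - 1

/-- One reduction step on walks: delete a backtracking pair `(x y)(y x)` or a
one-edge loop step `(x x)`. -/
def RStep (l l' : List V) : Prop :=
  (∃ (p s : List V) (x y : V), l = p ++ [x, y, x] ++ s ∧ l' = p ++ [x] ++ s) ∨
  (∃ (p s : List V) (x : V), l = p ++ [x, x] ++ s ∧ l' = p ++ [x] ++ s)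

/-- Equality of walks in the fundamental groupoid `π(H)`: the equivalence
generated by reduction steps (two walks are equal in `π(H)` iff they reduce to
the same reduced walk). -/
def PiEq (l l' : List V) : Prop := Relation.EqvGen RStep l l'

/-- A walk is reduced if no reduction step applies to it. -/
def IsReduced (l : List V) : Prop := ∀ l', ¬ RStep l l'

/-- A closed walk is cyclically reduced if it is reduced and its first and last
edges are not inverses of each other. -/
def IsCycReduced (l : List V) : Prop :=
  IsReduced l ∧ ∃ h : 2 ≤ l.length,
    l.get ⟨1, by omega⟩ ≠ l.get ⟨l.length - 2, by omega⟩

/-- `n`-fold concatenation of a closed walk `R` based at `h`. -/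
def witer (R : List V) (h : V) : ℕ → List V
  | 0 => [h]
  | n + 1 => wcomp R (witer R h n)

/-- `Rⁿ` for an integer `n`, for a closed walk `R` based at `h`; for `n < 0`
this is the `|n|`-fold concatenation of the reversed walk `R⁻¹`. -/
def zpowWalk (R : List V) (h : V) (n : ℤ) : List V :=
  if 0 ≤ n then witer R h n.toNat else witer R.reverse h (-n).toNat

/-- A walk is symmetric if every edge it traverses is a symmetric arc. -/
def IsSymWalk (H : Dgraph X) (l : List X) : Prop :=
  l.Chain' fun a b => H.Adj a b ∧ H.Adj b a

/-- The conjugated walk `α(W)⁻¹ · Q · β(W)`. -/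
def conj (α β : V → X) (Wl : List V) (Q : List X) : List X :=
  wcomp (wcomp (Wl.map α).reverse Q) (Wl.map β)

/-- Topological validity of a walk `Q` from `α q` to `β q`:
`β(C) = Q⁻¹ · α(C) · Q` in `π(H)` for every closed walk `C` at `q`. -/
def TopValid (G : Dgraph V) (H : Dgraph X) (α β : V → X) (q : V) (Q : List X) : Prop :=
  ∀ C : List V, IsWalk G q q C →
    PiEq (C.map β) (wcomp (wcomp Q.reverse (C.map α)) Q)

/-- IN-zigzag pattern `a₁ ← a₂ → a₃ ← … ← a_{n-1} → a_n`. -/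
def INCompatible (H : Dgraph X) (l : List X) : Prop :=
  ∀ (i : ℕ) (h : i + 1 < l.length),
    if i % 2 = 0 then H.Adj (l.get ⟨i + 1, h⟩) (l.get ⟨i, by omega⟩)
    else H.Adj (l.get ⟨i, by omega⟩) (l.get ⟨i + 1, h⟩)

/-- OUT-zigzag pattern `a₁ → a₂ ← a₃ → … → a_{n-1} ← a_n`. -/
def OUTCompatible (H : Dgraph X) (l : List X) : Prop :=
  ∀ (i : ℕ) (h : i + 1 < l.length),
    if i % 2 = 0 then H.Adj (l.get ⟨i, by omega⟩) (l.get ⟨i + 1, h⟩)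
    else H.Adj (l.get ⟨i + 1, h⟩) (l.get ⟨i, by omega⟩)

/-- A vertex is of type IN if it has an in-neighbor. -/
def TypeIN (G : Dgraph V) (v : V) : Prop := ∃ u, G.Adj u v

/-- A vertex is of type OUT if it has an out-neighbor. -/
def TypeOUT (G : Dgraph V) (v : V) : Prop := ∃ u, G.Adj v u

/-- A vertex is of type SYM if it is of type IN and of type OUT. -/
def TypeSYM (G : Dgraph V) (v : V) : Prop := TypeIN G v ∧ TypeOUT G v

/-- The zigzag condition for the vertex `v`. -/
def Zigzag (G : Dgraph V) (H : Dgraph X) (v : V) (l : List X) : Prop :=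
  (TypeIN G v → INCompatible H l) ∧ (TypeOUT G v → OUTCompatible H l)

/-- A recoloring sequence: a nonempty sequence of homomorphisms in which
consecutive homomorphisms differ on exactly one vertex. -/
def IsRecolSeq (G : Dgraph V) (H : Dgraph X) (σs : List (V → X)) : Prop :=
  σs ≠ [] ∧ (∀ σ ∈ σs, IsHom G H σ) ∧ σs.Chain' fun σ σ' => ∃! u, σ u ≠ σ' u

/-- The monochromatic neighborhood property: whenever a vertex changes its
color, all of its neighbors (in the underlying undirected graph) have one
common color. -/
def MonoNbhd (G : Dgraph V) (σs : List (V → X)) : Prop :=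
  σs.Chain' fun σ σ' => ∀ v, σ v ≠ σ' v → ∃ h, ∀ w, G.UAdj v w → σ w = h

/-- `VWalk G v σs S`: `S` is the vertex walk `S(v)` of the recoloring sequence
`σs`; each color change of `v` from `a` to `b`, while all neighbors of `v` are
colored `h`, contributes the two edges `(a h)(h b)`. -/
inductive VWalk (G : Dgraph V) (v : V) : List (V → X) → List X → Prop
  | single (σ : V → X) : VWalk G v [σ] [σ v]
  | stay {σ σ' : V → X} {rest : List (V → X)} {l : List X} :
      σ v = σ' v → VWalk G v (σ' :: rest) l → VWalk G v (σ :: σ' :: rest) l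
  | move {σ σ' : V → X} {rest : List (V → X)} {l : List X} (h : X) :
      σ v ≠ σ' v → (∀ w, G.UAdj v w → σ w = h) →
      VWalk G v (σ' :: rest) l → VWalk G v (σ :: σ' :: rest) (σ v :: h :: l)

/-- `H`-realizability of a walk `Q` via recoloring sequences satisfying the
monochromatic neighborhood property: `Q = S(q)` in `π(H)`. -/
def MRealizable (G : Dgraph V) (H : Dgraph X) (α β : V → X) (q : V) (Q : List X) : Prop :=
  ∃ (σs : List (V → X)) (Sq : List X),
    IsRecolSeq G H σs ∧ σs.head? = some α ∧ σs.getLast? = some β ∧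
    MonoNbhd G σs ∧ VWalk G q σs Sq ∧ PiEq Sq Q

/-- Orientation compatibility of a walk `Q`: every generated vertex walk
satisfies the zigzag condition. -/
def OrientCompatible (G : Dgraph V) (H : Dgraph X) (α β : V → X) (q : V) (Q : List X) : Prop :=
  ∀ (v : V) (Wl : List V), IsWalk G q v Wl →
    ∀ S : List X, IsReduced S → PiEq (conj α β Wl Q) S → Zigzag G H v S

/-- Hom₁-adjacency: the homomorphisms differ on exactly one vertex and, for
every arc `x → y` of `G`, both `φ x → ψ y` and `ψ x → φ y` are arcs of `H`. -/
def Hom1Adj (G : Dgraph V) (H : Dgraph X) (φ ψ : V → X) : Prop :=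
  (∃! u, φ u ≠ ψ u) ∧ ∀ ⦃x y⦄, G.Adj x y → H.Adj (φ x) (ψ y) ∧ H.Adj (ψ x) (φ y)

/-- A recoloring sequence in the Hom₁ sense (digraphs). -/
def Hom1Seq (G : Dgraph V) (H : Dgraph X) (σs : List (V → X)) : Prop :=
  σs ≠ [] ∧ (∀ σ ∈ σs, IsHom G H σ) ∧ σs.Chain' (Hom1Adj G H)

/-- A recoloring sequence in which each step recolors exactly one vertex to an
adjacent color (the Hom₁ sense for reflexive undirected graphs). -/
def AdjRecolSeq (G : Dgraph V) (H : Dgraph X) (σs : List (V → X)) : Prop :=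
  σs ≠ [] ∧ (∀ σ ∈ σs, IsHom G H σ) ∧
  σs.Chain' fun σ σ' => (∃! u, σ u ≠ σ' u) ∧ ∀ u, σ u ≠ σ' u → H.Adj (σ u) (σ' u)

/-- The push-or-pull property: whenever a vertex changes its color from `a` to
`b`, every neighbor of that vertex has color `a` or `b`. -/
def PushOrPull (G : Dgraph V) (σs : List (V → X)) : Prop :=
  σs.Chain' fun σ σ' => ∀ u, σ u ≠ σ' u → ∀ w, G.UAdj u w → σ w = σ u ∨ σ w = σ' u

/-- The walk of successive colors of `v` along a recoloring sequence. -/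
def colorWalk (σs : List (V → X)) (v : V) : List X := σs.map fun σ => σ v

/-- `H`-realizability via recoloring sequences (reflexive undirected Hom₁
sense) satisfying the push-or-pull property. -/
def PRealizable (G : Dgraph V) (H : Dgraph X) (α β : V → X) (q : V) (Q : List X) : Prop :=
  ∃ σs : List (V → X), AdjRecolSeq G H σs ∧ σs.head? = some α ∧ σs.getLast? = some β ∧
    PushOrPull G σs ∧ PiEq (colorWalk σs q) Q

/-- `H`-realizability via Hom₁ recoloring sequences of digraphs satisfying the
push-or-pull property. -/
def DRealizable (G : Dgraph V) (H : Dgraph X) (α β : V → X) (q : V) (Q : List X) : Prop :=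
  ∃ σs : List (V → X), Hom1Seq G H σs ∧ σs.head? = some α ∧ σs.getLast? = some β ∧
    PushOrPull G σs ∧ PiEq (colorWalk σs q) Q

/-- `H` contains no 4-cycle of algebraic girth 0 as a subgraph (neither of the
two orientations of the 4-cycle with two forward and two backward arcs). -/
def NoZeroGirthC4 (H : Dgraph X) : Prop :=
  ∀ a b c d : X, a ≠ b → a ≠ c → a ≠ d → b ≠ c → b ≠ d → c ≠ d →
    ¬(H.Adj a b ∧ H.Adj b d ∧ H.Adj a c ∧ H.Adj c d) ∧
    ¬(H.Adj a b ∧ H.Adj d b ∧ H.Adj a c ∧ H.Adj d c)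

/-- `H` contains no triangle of algebraic girth 1 as a subgraph. -/
def NoOneGirthTriangle (H : Dgraph X) : Prop :=
  ∀ x y z : X, x ≠ y → y ≠ z → x ≠ z → ¬(H.Adj x y ∧ H.Adj y z ∧ H.Adj x z)

/-- A path in the reconfiguration graph `R_H(G)` from `α` to `β`. -/
def IsRPath (G : Dgraph V) (H : Dgraph X) (α β : V → X) (L : List (V → X)) : Prop :=
  L ≠ [] ∧ L.head? = some α ∧ L.getLast? = some β ∧
  (∀ σ ∈ L, IsHom G H σ) ∧ L.Chain' fun φ ψ => ∃! u, φ u ≠ ψ u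

/-- A path in the graph `Hom₁(G, H)` from `α` to `β`. -/
def IsHom1Path (G : Dgraph V) (H : Dgraph X) (α β : V → X) (L : List (V → X)) : Prop :=
  L ≠ [] ∧ L.head? = some α ∧ L.getLast? = some β ∧
  (∀ σ ∈ L, IsHom G H σ) ∧ L.Chain' (Hom1Adj G H)

/-- The set of reduced walks `Q` from `α q` to `β q` that generate symmetric
vertex walks on `V'` with the system of walks `Wf`. -/
def SymGenSet (H : Dgraph X) (α β : V → X) (q : V)
    (V' : Set V) (Wf : V → List V) : Set (List X) :=
  {Q | IsWalk H (α q) (β q) Q ∧ IsReduced Q ∧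
    ∀ v ∈ V', ∀ S : List X, IsReduced S → PiEq (conj α β (Wf v) Q) S → IsSymWalk H S}

/-- The set of orientation-compatible walks for `q` and the system `Uf`. -/
def OCSet (G : Dgraph V) (H : Dgraph X) (α β : V → X) (q : V)
    (Uf : V → List V) : Set (List X) :=
  {Q | IsWalk H (α q) (β q) Q ∧ IsReduced Q ∧ Even (wlen Q) ∧
    ∀ (v : V) (S : List X), IsReduced S → PiEq (conj α β (Uf v) Q) S → Zigzag G H v S}

/-- The set `Π_q` of walks from `α q` to `β q` that are `H`-realizable via
recoloring sequences satisfying the monochromatic neighborhood property. -/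
def MRealSet (G : Dgraph V) (H : Dgraph X) (α β : V → X) (q : V) : Set (List X) :=
  {Q | IsWalk H (α q) (β q) Q ∧ IsReduced Q ∧ MRealizable G H α β q Q}

/-- The set of walks from `α q` to `β q` that are `H`-realizable via
recoloring sequences satisfying the push-or-pull property. -/
def PRealSet (G : Dgraph V) (H : Dgraph X) (α β : V → X) (q : V) : Set (List X) :=
  {Q | IsWalk H (α q) (β q) Q ∧ IsReduced Q ∧ PRealizable G H α β q Q}

/-- Ceiling division on natural numbers. -/
def cdiv (a b : ℕ) : ℕ := (a + b - 1) / b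

end HRecoloring

namespace HRecoloring

variable {V X : Type}

/-! ### Centralizers in free groups -/

/-- A free group with a nontrivial central element has at most one generator. -/
lemma subsingleton_of_central {ι : Type*} (z : FreeGroup ι) (hz : z ≠ 1)
    (hc : ∀ x, x * z = z * x) : Subsingleton ι := by
  classical
  have hne : z.toWord ≠ [] := fun h => hz (FreeGroup.toWord_eq_nil_iff.1 h)
  have hred := FreeGroup.isReduced_toWord (x := z)
  obtain ⟨c, t, ht⟩ := List.exists_cons_of_ne_nil hne
  suffices h : ∀ y : ι, y = c.1 from ⟨fun a b => (h a).trans (h b).symm⟩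
  intro y
  by_contra hy
  set d := z.toWord.getLast hne with hd
  have hcomm : FreeGroup.mk ((y, d.2) :: z.toWord) = FreeGroup.mk (z.toWord ++ [(y, d.2)]) := by
    have h := hc (FreeGroup.mk [(y, d.2)])
    rw [← FreeGroup.mk_toWord (x := z)] at h
    simpa [FreeGroup.mul_mk] using h
  have h1 : FreeGroup.IsReduced ((y, d.2) :: z.toWord) := by
    rw [ht] at hred ⊢
    exact List.isChain_cons_cons.2 ⟨fun h => absurd h hy, hred⟩
  have h2 : FreeGroup.IsReduced (z.toWord ++ [(y, d.2)]) := by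
    refine List.isChain_append.2 ⟨hred, List.isChain_singleton _, ?_⟩
    intro a ha b hb hab
    rw [List.getLast?_eq_getLast_of_ne_nil hne] at ha
    simp at ha hb
    rw [← ha, ← hb, ← hd]
  have h3 := FreeGroup.reduce.sound hcomm
  rw [h1.reduce_eq, h2.reduce_eq, ht] at h3
  simp only [List.cons_append, List.cons.injEq] at h3
  exact hy (congrArg Prod.fst h3.1)

/-- A subgroup of a free group that centralizes a nontrivial element is cyclic. -/
lemma exists_zpowers_of_centralizes {ι : Type} (c : FreeGroup ι) (hc : c ≠ 1)
    (A : Subgroup (FreeGroup ι)) (hA : ∀ a ∈ A, a * c = c * a) :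
    ∃ r, A = Subgroup.zpowers r := by
  set C := Subgroup.centralizer ({c} : Set (FreeGroup ι)) with hC
  have hAC : A ≤ C := by
    intro a ha
    rw [hC, Subgroup.mem_centralizer_singleton_iff]
    exact hA a ha
  have hcC : c ∈ C := by rw [hC, Subgroup.mem_centralizer_singleton_iff]
  let e := IsFreeGroup.toFreeGroup C
  have hsub : Subsingleton (IsFreeGroup.Generators C) := by
    refine subsingleton_of_central (e ⟨c, hcC⟩) ?_ ?_
    · intro h
      rw [map_eq_one_iff e e.injective] at h
      exact hc (congrArg Subtype.val h)
    · intro x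
      obtain ⟨y, rfl⟩ := e.surjective x
      rw [← map_mul, ← map_mul]
      congr 1
      apply Subtype.ext
      exact (Subgroup.mem_centralizer_singleton_iff.1 (hC ▸ y.2))
  have hcyc : IsCyclic (FreeGroup (IsFreeGroup.Generators C)) := by
    rcases isEmpty_or_nonempty (IsFreeGroup.Generators C) with h | ⟨⟨a⟩⟩
    · infer_instance
    · have : Unique (IsFreeGroup.Generators C) := ⟨⟨a⟩, fun b => Subsingleton.elim b a⟩
      infer_instance
  have hcC : IsCyclic C := isCyclic_of_surjective e.symm.toMonoidHom e.symm.surjective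
  have := Subgroup.isCyclic_of_le hAC
  obtain ⟨r, hr⟩ := (Subgroup.isCyclic_iff_exists_zpowers_eq_top A).1 this
  exact ⟨r, hr.symm⟩

/-! ### Walks as elements of a free group -/

/-- The free group element of a single edge; opposite edges are mutually inverse. -/
def edge (a b : X) : FreeGroup (X × X) := FreeGroup.of (a, b) * (FreeGroup.of (b, a))⁻¹

@[simp] lemma edge_self (a : X) : edge a a = 1 := by simp [edge]

@[simp] lemma edge_inv (a b : X) : (edge a b)⁻¹ = edge b a := by simp [edge]

@[simp] lemma edge_mul_edge (a b : X) : edge a b * edge b a = 1 := by simp [edge]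

@[simp] lemma edge_mul_edge_mul (a b : X) (w : FreeGroup (X × X)) :
    edge a b * (edge b a * w) = w := by
  rw [← mul_assoc, edge_mul_edge, one_mul]

/-- The free group element of a walk. -/
def gam : List X → FreeGroup (X × X)
  | [] => 1
  | [_] => 1
  | a :: b :: t => edge a b * gam (b :: t)

@[simp] lemma gam_nil : gam ([] : List X) = 1 := rfl
@[simp] lemma gam_singleton (a : X) : gam [a] = 1 := rfl
@[simp] lemma gam_cons_cons (a b : X) (t : List X) :
    gam (a :: b :: t) = edge a b * gam (b :: t) := rfl

lemma gam_append (l : List X) (x : X) (t : List X) :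
    gam (l ++ x :: t) = gam (l ++ [x]) * gam (x :: t) := by
  induction l with
  | nil => simp
  | cons a l ih =>
    cases l with
    | nil => simp
    | cons b l => simp only [List.cons_append, gam_cons_cons] at ih ⊢; rw [ih, mul_assoc]

lemma gam_reverse (l : List X) : gam l.reverse = (gam l)⁻¹ := by
  induction l with
  | nil => simp
  | cons a l ih =>
    cases l with
    | nil => simp
    | cons b l =>
      have : (a :: b :: l).reverse = l.reverse ++ b :: [a] := by simp
      rw [this, gam_append]
      rw [List.reverse_cons] at ih
      rw [ih]
      simp

lemma gam_wcomp (l l' : List X) (x : X) (h : l.getLast? = some x) (h' : l'.head? = some x) :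
    gam (wcomp l l') = gam l * gam l' := by
  obtain ⟨t, rfl⟩ : ∃ t, l' = x :: t := by
    cases l' with
    | nil => simp at h'
    | cons a t => simp at h'; exact ⟨t, by rw [h']⟩
  obtain ⟨p, rfl⟩ : ∃ p, l = p ++ [x] := by
    obtain ⟨hne, hx⟩ := List.getLast?_eq_some_iff.1 h
    exact ⟨hne, hx⟩
  have : wcomp (p ++ [x]) (x :: t) = p ++ x :: t := by simp [wcomp]
  rw [this, gam_append]

lemma RStep.gam_eq {l l' : List X} (h : RStep l l') : gam l = gam l' := by
  rcases h with ⟨p, s, x, y, rfl, rfl⟩ | ⟨p, s, x, rfl, rfl⟩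
  · simp only [List.append_assoc, List.cons_append, List.nil_append]
    rw [gam_append, gam_append p x s]; simp
  · simp only [List.append_assoc, List.cons_append, List.nil_append]
    rw [gam_append, gam_append p x s]; simp

lemma RStep.head?_eq {l l' : List X} (h : RStep l l') : l.head? = l'.head? := by
  rcases h with ⟨p, s, x, y, rfl, rfl⟩ | ⟨p, s, x, rfl, rfl⟩ <;> cases p <;> simp

lemma PiEq.gam_eq {l l' : List X} (h : PiEq l l') : gam l = gam l' := by
  induction h with
  | rel _ _ h => exact h.gam_eq
  | refl => rfl
  | symm _ _ _ ih => exact ih.symm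
  | trans _ _ _ _ _ ih ih' => exact ih.trans ih'

lemma PiEq.head?_eq {l l' : List X} (h : PiEq l l') : l.head? = l'.head? := by
  induction h with
  | rel _ _ h => exact h.head?_eq
  | refl => rfl
  | symm _ _ _ ih => exact ih.symm
  | trans _ _ _ _ _ ih ih' => exact ih.trans ih'

/-! ### Reduced walks -/

lemma isReduced_iff (l : List X) : IsReduced l ↔
    (∀ p s x y, l ≠ p ++ [x, y, x] ++ s) ∧ ∀ p s x, l ≠ p ++ [x, x] ++ s := by
  constructor
  · intro h
    exact ⟨fun p s x y e => h _ (Or.inl ⟨p, s, x, y, e, rfl⟩),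
      fun p s x e => h _ (Or.inr ⟨p, s, x, e, rfl⟩)⟩
  · rintro ⟨h1, h2⟩ l' (⟨p, s, x, y, e, -⟩ | ⟨p, s, x, e, -⟩)
    · exact h1 _ _ _ _ e
    · exact h2 _ _ _ e

lemma IsReduced.of_append {p l s : List X} (h : IsReduced (p ++ l ++ s)) : IsReduced l := by
  rw [isReduced_iff] at h ⊢
  refine ⟨fun p' s' x y e => h.1 (p ++ p') (s' ++ s) x y ?_,
    fun p' s' x e => h.2 (p ++ p') (s' ++ s) x ?_⟩ <;> rw [e] <;> simp

lemma IsReduced.tail {x : X} {l : List X} (h : IsReduced (x :: l)) : IsReduced l :=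
  IsReduced.of_append (p := [x]) (s := []) (by simpa using h)

lemma IsReduced.reverse {l : List X} (h : IsReduced l) : IsReduced l.reverse := by
  rw [isReduced_iff] at h ⊢
  refine ⟨fun p s x y e => h.1 s.reverse p.reverse x y ?_,
    fun p s x e => h.2 s.reverse p.reverse x ?_⟩ <;>
  · rw [← List.reverse_reverse l, e]; simp

@[simp] lemma isReduced_singleton (x : X) : IsReduced [x] := by
  rw [isReduced_iff]
  constructor
  · intro p s a b e
    have := congrArg List.length e
    simp at this
    omega
  · intro p s a e
    have := congrArg List.length e
    simp at this
    omega

lemma isReduced_cons_cons (x y : X) (t : List X) : IsReduced (x :: y :: t) ↔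
    x ≠ y ∧ t.head? ≠ some x ∧ IsReduced (y :: t) := by
  constructor
  · intro h
    refine ⟨?_, ?_, h.tail⟩
    · rintro rfl
      exact ((isReduced_iff _).1 h).2 [] t x (by simp)
    · intro ht
      cases t with
      | nil => simp at ht
      | cons z t =>
        simp at ht
        subst ht
        exact ((isReduced_iff _).1 h).1 [] t z y (by simp)
  · rintro ⟨h1, h2, h3⟩
    rw [isReduced_iff] at h3 ⊢
    constructor
    · intro p s a b e
      cases p with
      | nil => simp at e; obtain ⟨rfl, rfl, rfl⟩ := e; simp at h2
      | cons c p => simp at e; exact h3.1 p s a b (by simpa using e.2)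
    · intro p s a e
      cases p with
      | nil => simp at e; obtain ⟨rfl, rfl, rfl⟩ := e; simp at h1
      | cons c p => simp at e; exact h3.2 p s a (by simpa using e.2)

/-- The word spelled by a walk. -/
def letters : List X → List ((X × X) × Bool)
  | [] => []
  | [_] => []
  | a :: b :: t => ((a, b), true) :: ((b, a), false) :: letters (b :: t)

lemma mk_letters (l : List X) : FreeGroup.mk (letters l) = gam l := by
  induction l with
  | nil => rfl
  | cons a l ih =>
    cases l with
    | nil => rfl
    | cons b t =>
      rw [gam_cons_cons, ← ih, edge]
      simp only [letters, FreeGroup.of, FreeGroup.inv_mk, FreeGroup.mul_mk]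
      rfl

lemma isReduced_letters {l : List X} (h : IsReduced l) : FreeGroup.IsReduced (letters l) := by
  induction l with
  | nil => simp [letters]
  | cons a l ih =>
    cases l with
    | nil => simp [letters]
    | cons b t =>
      rw [isReduced_cons_cons] at h
      have ih := ih h.2.2
      have hab := h.1
      cases t with
      | nil =>
        simp only [letters, FreeGroup.IsReduced, List.isChain_cons_cons]
        simp [hab]
      | cons c t =>
        have hac : a ≠ c := fun e => h.2.1 (by simp [e])
        simp only [letters, FreeGroup.IsReduced, List.isChain_cons_cons] at ih ⊢
        refine ⟨?_, ?_, ih⟩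
        · simp [hab]
        · simp [hac]

lemma letters_length (l : List X) : (letters l).length = 2 * (l.length - 1) := by
  induction l with
  | nil => rfl
  | cons a l ih =>
    cases l with
    | nil => rfl
    | cons b t => simp [letters, ih]; ring

open scoped Classical in
lemma norm_gam {l : List X} (h : IsReduced l) : (gam l).norm = 2 * (l.length - 1) := by
  rw [FreeGroup.norm, ← mk_letters, FreeGroup.toWord_mk, (isReduced_letters h).reduce_eq,
    letters_length]

lemma eq_of_letters_eq : ∀ {l l' : List X}, l.head? = l'.head? → letters l = letters l' → l = l'
  | [], [], _, _ => rfl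
  | [], _ :: _, h, _ => by simp at h
  | _ :: _, [], h, _ => by simp at h
  | [a], [b], h, _ => by simpa using h
  | [_], _ :: _ :: _, _, h => by simp [letters] at h
  | _ :: _ :: _, [_], _, h => by simp [letters] at h
  | a :: b :: t, a' :: b' :: t', _, h => by
    simp only [letters, List.cons.injEq, Prod.mk.injEq] at h
    have := eq_of_letters_eq (l := b :: t) (l' := b' :: t') (by simp [h.1.1.2]) h.2.2
    rw [h.1.1.1, this]

/-- A reduced walk is determined by its first vertex and its free group element. -/
lemma IsReduced.eq_of_gam {l l' : List X} (h : IsReduced l) (h' : IsReduced l')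
    (hh : l.head? = l'.head?) (hg : gam l = gam l') : l = l' := by
  classical
  apply eq_of_letters_eq hh
  rw [← mk_letters, ← mk_letters] at hg
  have := FreeGroup.reduce.sound hg
  rwa [(isReduced_letters h).reduce_eq, (isReduced_letters h').reduce_eq] at this

open scoped Classical in
/-- Prepend a vertex to a reduced walk and reduce. -/
noncomputable def rcons (x : X) : List X → List X
  | [] => [x]
  | y :: t => if x = y then y :: t else if t.head? = some x then t else x :: y :: t

lemma rcons_cases (x y : X) (t : List X) :
    (x = y ∧ rcons x (y :: t) = y :: t) ∨
    (x ≠ y ∧ ∃ t', t = x :: t' ∧ rcons x (y :: t) = x :: t') ∨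
    (x ≠ y ∧ t.head? ≠ some x ∧ rcons x (y :: t) = x :: y :: t) := by
  by_cases hxy : x = y
  · exact Or.inl ⟨hxy, by simp [rcons, hxy]⟩
  by_cases ht : t.head? = some x
  · refine Or.inr (Or.inl ⟨hxy, ?_⟩)
    cases t with
    | nil => simp at ht
    | cons z t =>
      simp at ht
      exact ⟨t, by rw [ht], by simp [rcons, hxy, ht]⟩
  · exact Or.inr (Or.inr ⟨hxy, ht, by simp [rcons, hxy, ht]⟩)

lemma isReduced_rcons (x : X) {l : List X} (h : IsReduced l) : IsReduced (rcons x l) := by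
  cases l with
  | nil => simp [rcons]
  | cons y t =>
    rcases rcons_cases x y t with ⟨_, e⟩ | ⟨_, t', rfl, e⟩ | ⟨h1, h2, e⟩ <;> rw [e]
    · exact h
    · exact h.tail
    · exact (isReduced_cons_cons _ _ _).2 ⟨h1, h2, h⟩

@[simp] lemma head?_rcons (x : X) (l : List X) : (rcons x l).head? = some x := by
  cases l with
  | nil => simp [rcons]
  | cons y t =>
    rcases rcons_cases x y t with ⟨rfl, e⟩ | ⟨_, t', rfl, e⟩ | ⟨h1, h2, e⟩ <;> rw [e] <;> simp

lemma getLast?_rcons (x y : X) (t : List X) :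
    (rcons x (y :: t)).getLast? = (y :: t).getLast? := by
  rcases rcons_cases x y t with ⟨rfl, e⟩ | ⟨_, t', rfl, e⟩ | ⟨h1, h2, e⟩ <;> rw [e]
  · simp
  · simp

@[simp] lemma gam_rcons (x y : X) (t : List X) :
    gam (rcons x (y :: t)) = edge x y * gam (y :: t) := by
  rcases rcons_cases x y t with ⟨rfl, e⟩ | ⟨_, t', rfl, e⟩ | ⟨h1, h2, e⟩ <;> rw [e] <;> simp

lemma PiEq.cons {l l' : List X} (x : X) (h : PiEq l l') : PiEq (x :: l) (x :: l') := by
  induction h with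
  | rel l l' h =>
    refine .rel _ _ ?_
    rcases h with ⟨p, s, a, b, rfl, rfl⟩ | ⟨p, s, a, rfl, rfl⟩
    · exact Or.inl ⟨x :: p, s, a, b, rfl, rfl⟩
    · exact Or.inr ⟨x :: p, s, a, rfl, rfl⟩
  | refl => exact .refl _
  | symm _ _ _ ih => exact ih.symm
  | trans _ _ _ _ _ ih ih' => exact ih.trans _ _ _ ih'

lemma piEq_rcons (x : X) (l : List X) : PiEq (x :: l) (rcons x l) := by
  cases l with
  | nil => exact .refl _
  | cons y t =>
    rcases rcons_cases x y t with ⟨rfl, e⟩ | ⟨_, t', rfl, e⟩ | ⟨h1, h2, e⟩ <;> rw [e]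
    · exact .rel _ _ (Or.inr ⟨[], t, x, rfl, rfl⟩)
    · exact .rel _ _ (Or.inl ⟨[], t', x, y, rfl, rfl⟩)
    · exact .refl _

lemma exists_piEq_isReduced (l : List X) (hl : l ≠ []) : ∃ l', PiEq l l' ∧ IsReduced l' := by
  induction l with
  | nil => exact absurd rfl hl
  | cons a l ih =>
    cases l with
    | nil => exact ⟨[a], .refl _, isReduced_singleton a⟩
    | cons b t =>
      obtain ⟨l', h1, h2⟩ := ih (by simp)
      exact ⟨rcons a l', (h1.cons a).trans _ _ _ (piEq_rcons a l'), isReduced_rcons a h2⟩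

/-- Walks with the same first vertex and the same free group element agree in `π(H)`. -/
lemma piEq_of_gam {l l' : List X} (hl : l ≠ []) (hh : l.head? = l'.head?)
    (hg : gam l = gam l') : PiEq l l' := by
  have hl' : l' ≠ [] := by
    rintro rfl
    cases l <;> simp_all
  obtain ⟨m, h1, h2⟩ := exists_piEq_isReduced l hl
  obtain ⟨m', h1', h2'⟩ := exists_piEq_isReduced l' hl'
  have : m = m' := h2.eq_of_gam h2' (by rw [← h1.head?_eq, ← h1'.head?_eq, hh])
    (by rw [← h1.gam_eq, ← h1'.gam_eq, hg])
  subst this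
  exact h1.trans _ _ _ h1'.symm

lemma length_rcons (x y : X) (t : List X) (h : x ≠ y) :
    (Even (rcons x (y :: t)).length ↔ Odd (y :: t).length) := by
  rcases rcons_cases x y t with ⟨rfl, e⟩ | ⟨_, t', rfl, e⟩ | ⟨h1, h2, e⟩
  · exact absurd rfl h
  · rw [e]; simp [Nat.even_add_one, Nat.odd_add_one]
  · rw [e]; simp [Nat.even_add_one, Nat.odd_add_one]

/-! ### Zigzag walks -/

/-- The IN-zigzag pattern if `i` holds and the OUT-zigzag pattern if `o` holds. -/
def ZG (H : Dgraph X) (i o : Prop) : List X → Prop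
  | [] => True
  | [_] => True
  | a :: b :: t => ((i → H.Adj b a) ∧ (o → H.Adj a b)) ∧ ZG H o i (b :: t)

@[simp] lemma ZG_singleton (H : Dgraph X) (i o : Prop) (a : X) : ZG H i o [a] := trivial

lemma ZG_cons_cons (H : Dgraph X) (i o : Prop) (a b : X) (t : List X) :
    ZG H i o (a :: b :: t) ↔ ((i → H.Adj b a) ∧ (o → H.Adj a b)) ∧ ZG H o i (b :: t) := Iff.rfl

lemma ZG.mono {H : Dgraph X} {l : List X} : ∀ {i o i' o' : Prop}, (i' → i) → (o' → o) →
    ZG H i o l → ZG H i' o' l := by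
  induction l with
  | nil => intros; trivial
  | cons a l ih =>
    cases l with
    | nil => intros; trivial
    | cons b t =>
      intro i o i' o' hi ho h
      exact ⟨⟨fun k => h.1.1 (hi k), fun k => h.1.2 (ho k)⟩, ih ho hi h.2⟩

lemma inCompatible_cons_cons (H : Dgraph X) (a b : X) (t : List X) :
    INCompatible H (a :: b :: t) ↔ H.Adj b a ∧ OUTCompatible H (b :: t) := by
  constructor
  · intro h
    refine ⟨by simpa using h 0 (by simp), fun j hj => ?_⟩
    have := h (j + 1) (by simpa using hj)
    rcases Nat.mod_two_eq_zero_or_one j with e | e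
    · have e' : (j + 1) % 2 = 1 := by omega
      simpa [e, e'] using this
    · have e' : (j + 1) % 2 = 0 := by omega
      simpa [e, e'] using this
  · rintro ⟨h1, h2⟩ j hj
    cases j with
    | zero => simpa using h1
    | succ j =>
      have := h2 j (by simpa using hj)
      rcases Nat.mod_two_eq_zero_or_one j with e | e
      · have e' : (j + 1) % 2 = 1 := by omega
        simpa [e, e'] using this
      · have e' : (j + 1) % 2 = 0 := by omega
        simpa [e, e'] using this

lemma outCompatible_cons_cons (H : Dgraph X) (a b : X) (t : List X) :
    OUTCompatible H (a :: b :: t) ↔ H.Adj a b ∧ INCompatible H (b :: t) := by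
  constructor
  · intro h
    refine ⟨by simpa using h 0 (by simp), fun j hj => ?_⟩
    have := h (j + 1) (by simpa using hj)
    rcases Nat.mod_two_eq_zero_or_one j with e | e
    · have e' : (j + 1) % 2 = 1 := by omega
      simpa [e, e'] using this
    · have e' : (j + 1) % 2 = 0 := by omega
      simpa [e, e'] using this
  · rintro ⟨h1, h2⟩ j hj
    cases j with
    | zero => simpa using h1
    | succ j =>
      have := h2 j (by simpa using hj)
      rcases Nat.mod_two_eq_zero_or_one j with e | e
      · have e' : (j + 1) % 2 = 1 := by omega
        simpa [e, e'] using this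
      · have e' : (j + 1) % 2 = 0 := by omega
        simpa [e, e'] using this

lemma ZG_iff (H : Dgraph X) (l : List X) : ∀ i o : Prop,
    ZG H i o l ↔ (i → INCompatible H l) ∧ (o → OUTCompatible H l) := by
  induction l with
  | nil => intro i o; simp [ZG, INCompatible, OUTCompatible]
  | cons a l ih =>
    cases l with
    | nil => intro i o; simp [ZG, INCompatible, OUTCompatible]
    | cons b t =>
      intro i o
      rw [ZG_cons_cons, ih, inCompatible_cons_cons, outCompatible_cons_cons]
      tauto

lemma ZG.isChain {H : Dgraph X} {l : List X} : ∀ {i o : Prop}, i ∨ o → ZG H i o l →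
    l.IsChain H.UAdj := by
  induction l with
  | nil => intros; exact List.isChain_nil
  | cons a l ih =>
    cases l with
    | nil => intros; exact List.isChain_singleton _
    | cons b t =>
      intro i o hio h
      refine List.isChain_cons_cons.2 ⟨?_, ih hio.symm h.2⟩
      rcases hio with hi | ho
      · exact Or.inr (h.1.1 hi)
      · exact Or.inl (h.1.2 ho)

lemma ZG.isWalk {H : Dgraph X} {l : List X} {i o : Prop} {a b : X} (hio : i ∨ o)
    (h : ZG H i o l) (ha : l.head? = some a) (hb : l.getLast? = some b) : IsWalk H a b l :=
  ⟨by rintro rfl; simp at ha, ha, hb, h.isChain hio⟩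

lemma ZG.of_append {H : Dgraph X} {l s : List X} : ∀ {i o : Prop},
    ZG H i o (l ++ s) → ZG H i o l := by
  induction l with
  | nil => intros; trivial
  | cons a l ih =>
    cases l with
    | nil => intros; trivial
    | cons b t => intro i o h; exact ⟨h.1, ih h.2⟩

lemma ZG.rcons {H : Dgraph X} {i o : Prop} {x y : X} {t : List X} (hxy : x ≠ y)
    (hi : i → H.Adj y x) (ho : o → H.Adj x y) (h : ZG H o i (y :: t)) :
    ZG H i o (rcons x (y :: t)) := by
  rcases rcons_cases x y t with ⟨rfl, e⟩ | ⟨_, t', rfl, e⟩ | ⟨h1, h2, e⟩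
  · exact absurd rfl hxy
  · rw [e]; exact h.2
  · rw [e]; exact ⟨⟨hi, ho⟩, h⟩

/-- `ZZ H i o a b w`: the element `w` is represented by a walk of even length from `a` to `b`
with the zigzag pattern prescribed by `i` and `o`. -/
inductive ZZ (H : Dgraph X) (i o : Prop) : X → X → FreeGroup (X × X) → Prop
  | refl (a : X) : ZZ H i o a a 1
  | cons {a b c : X} {w : FreeGroup (X × X)} (h : X) (hi : i → H.Adj h a ∧ H.Adj h b)
      (ho : o → H.Adj a h ∧ H.Adj b h) (hw : ZZ H i o b c w) :
      ZZ H i o a c (edge a h * edge h b * w)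

lemma ZZ.trans {H : Dgraph X} {i o : Prop} {a b c : X} {w w' : FreeGroup (X × X)}
    (h : ZZ H i o a b w) (h' : ZZ H i o b c w') : ZZ H i o a c (w * w') := by
  induction h with
  | refl a => simpa using h'
  | cons k hi ho _ ih => rw [mul_assoc]; exact .cons k hi ho (ih h')

lemma ZZ.symm {H : Dgraph X} {i o : Prop} {a b : X} {w : FreeGroup (X × X)}
    (h : ZZ H i o a b w) : ZZ H i o b a w⁻¹ := by
  induction h with
  | refl a => simpa using ZZ.refl a
  | @cons a b c w k hi ho _ ih =>
    have h1 : ZZ H i o b a (edge b k * edge k a * 1) :=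
      .cons k (fun h => (hi h).symm) (fun h => (ho h).symm) (.refl a)
    have := ih.trans h1
    simpa [mul_assoc] using this

lemma ZZ.exists_list {H : Dgraph X} (hH : H.Loopless) {i o : Prop} (hio : i ∨ o) {a b : X}
    {w : FreeGroup (X × X)} (h : ZZ H i o a b w) :
    ∃ l, IsReduced l ∧ l.head? = some a ∧ l.getLast? = some b ∧ Odd l.length ∧ ZG H i o l ∧
      gam l = w := by
  induction h with
  | refl a => exact ⟨[a], by simp⟩
  | @cons a b c w k hi ho _ ih =>
    obtain ⟨l, h1, h2, h3, h4, h5, rfl⟩ := ih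
    obtain ⟨t, rfl⟩ : ∃ t, l = b :: t := by
      cases l with
      | nil => simp at h2
      | cons x t => simp at h2; exact ⟨t, by rw [h2]⟩
    have hkb : k ≠ b := by
      rintro rfl
      rcases hio with h | h
      · exact hH _ (hi h).2
      · exact hH _ (ho h).2
    have hak : a ≠ k := by
      rintro rfl
      rcases hio with h | h
      · exact hH _ (hi h).1
      · exact hH _ (ho h).1
    obtain ⟨t', ht'⟩ : ∃ t', rcons k (b :: t) = k :: t' := by
      have := head?_rcons k (b :: t)
      cases hr : rcons k (b :: t) with
      | nil => simp [hr] at this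
      | cons x t' => simp [hr] at this; exact ⟨t', by rw [this]⟩
    have e1 := length_rcons k b t hkb
    have z1 : ZG H o i (rcons k (b :: t)) := h5.rcons hkb (fun h => (ho h).2) (fun h => (hi h).2)
    refine ⟨rcons a (rcons k (b :: t)), isReduced_rcons _ (isReduced_rcons _ h1),
      head?_rcons _ _, ?_, ?_, ?_, ?_⟩
    · rw [ht', getLast?_rcons, ← ht', getLast?_rcons, h3]
    · have e2 := length_rcons a k t' hak
      rw [← ht'] at e2
      rw [← Nat.not_even_iff_odd, e2, Nat.not_odd_iff_even, e1]
      exact h4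
    · rw [ht'] at z1 ⊢
      exact z1.rcons hak (fun h => (hi h).1) (fun h => (ho h).1)
    · rw [ht', gam_rcons, ← ht', gam_rcons, mul_assoc]

lemma ZG.zz {H : Dgraph X} {i o : Prop} : ∀ {l : List X} {a b : X}, ZG H i o l →
    l.head? = some a → l.getLast? = some b → Odd l.length → ZZ H i o a b (gam l)
  | [], _, _, _, h, _, _ => by simp at h
  | [x], a, b, _, ha, hb, _ => by
    simp at ha hb
    subst ha hb
    exact .refl _
  | [_, _], _, _, _, _, _, h => by simp [Nat.odd_iff] at h
  | x :: k :: y :: t, a, b, h, ha, hb, hl => by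
    simp only [List.head?_cons, Option.some.injEq] at ha
    subst ha
    have := ZG.zz (l := y :: t) (a := y) (b := b) h.2.2 (by simp) (by simpa using hb)
      (by simp [Nat.odd_add_one] at hl ⊢; exact hl)
    simpa [mul_assoc] using ZZ.cons k (fun hi => ⟨h.1.1 hi, h.2.1.2 hi⟩)
      (fun ho => ⟨h.1.2 ho, h.2.1.1 ho⟩) this

/-! ### Monochromatic reconfiguration -/

lemma Dgraph.UAdj.symm {G : Dgraph V} {u v : V} (h : G.UAdj u v) : G.UAdj v u := Or.symm h

lemma IsHom.uadj {G : Dgraph V} {H : Dgraph X} {f : V → X} (hf : IsHom G H f) {u v : V}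
    (h : G.UAdj u v) : H.UAdj (f u) (f v) :=
  h.imp (fun e => hf e) (fun e => hf e)

lemma Dgraph.UAdj.ne {G : Dgraph V} (hG : G.Loopless) {u v : V} (h : G.UAdj u v) : u ≠ v := by
  rintro rfl
  exact hG u (h.elim id id)

/-- `MR G H α β s`: some recoloring sequence from `α` to `β` with the monochromatic neighborhood
property moves each vertex `v` along a walk whose free group element is `s v`. -/
inductive MR (G : Dgraph V) (H : Dgraph X) :
    (V → X) → (V → X) → (V → FreeGroup (X × X)) → Prop
  | refl {α : V → X} {s : V → FreeGroup (X × X)} (hα : IsHom G H α) (hs : ∀ v, s v = 1) :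
      MR G H α α s
  | step {α α' β : V → X} {s s' : V → FreeGroup (X × X)} (v : V) (h : X) (hα : IsHom G H α)
      (hv : α v ≠ α' v) (hne : ∀ u, u ≠ v → α u = α' u) (hh : ∀ w, G.UAdj v w → α w = h)
      (hm : MR G H α' β s) (hsv : s' v = edge (α v) h * edge h (α' v) * s v)
      (hsu : ∀ u, u ≠ v → s' u = s u) : MR G H α β s'

section

variable {G : Dgraph V} {H : Dgraph X} {α β γ : V → X} {s s' : V → FreeGroup (X × X)}

lemma MR.isHom_left (h : MR G H α β s) : IsHom G H α := by
  cases h <;> assumption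

lemma MR.trans (h : MR G H α β s) (h' : MR G H β γ s') :
    MR G H α γ (fun v => s v * s' v) := by
  induction h with
  | @refl α s hα hs =>
    have : (fun v => s v * s' v) = s' := by funext v; rw [hs, one_mul]
    rwa [this]
  | step v k hα hv hne hh _ hsv hsu ih =>
    refine .step v k hα hv hne hh (ih h') ?_ ?_
    · rw [hsv, mul_assoc]
    · intro u hu; rw [hsu u hu]

lemma MR.symm (hG : G.Loopless) (h : MR G H α β s) : MR G H β α (fun v => (s v)⁻¹) := by
  induction h with
  | refl hα hs => exact .refl hα (by simp [hs])
  | @step α α' β s s' v k hα hv hne hh hm hsv hsu ih =>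
    classical
    have h1 : MR G H α' α (fun u => if u = v then edge (α' v) k * edge k (α v) * 1 else 1) := by
      refine .step (s := fun _ => 1) v k hm.isHom_left hv.symm (fun u hu => (hne u hu).symm) ?_
        (.refl hα fun _ => rfl) (by simp) (fun u hu => by simp [hu])
      intro w hw
      rw [← hne w (hw.ne hG).symm, hh w hw]
    have h2 := ih.trans h1
    convert h2 using 2 with u
    by_cases hu : u = v
    · subst hu
      simp [hsv, mul_assoc]
    · simp [hu, hsu u hu]

/-- Topological validity. -/
lemma MR.topological (hG : G.Loopless) (h : MR G H α β s) {u v : V} (huv : G.UAdj u v) :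
    s v = edge (α v) (α u) * s u * edge (β u) (β v) := by
  induction h with
  | refl hα hs => simp [hs]
  | @step α α' β s s' x k hα hx hne hh hm hsv hsu ih =>
    have hne' := huv.ne hG
    by_cases hu : u = x
    · subst hu
      rw [hsv, hsu v hne'.symm, ih, hh v huv, ← hne v hne'.symm, hh v huv]
      simp [mul_assoc]
    · by_cases hv : v = x
      · subst hv
        rw [hsv, hsu u hu, ih, hh u huv.symm, ← hne u hu, hh u huv.symm]
        simp [mul_assoc]
      · rw [hsu u hu, hsu v hv, ih, hne u hu, hne v hv]

lemma MR.zz (hG : G.Loopless) (h : MR G H α β s) (v : V) :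
    ZZ H (TypeIN G v) (TypeOUT G v) (α v) (β v) (s v) := by
  induction h with
  | refl hα hs => rw [hs]; exact .refl _
  | @step α α' β s s' x k hα hx hne hh hm hsv hsu ih =>
    by_cases hv : v = x
    · subst hv
      rw [hsv]
      refine .cons k ?_ ?_ ih
      · rintro ⟨u, hu⟩
        have e := hh u (Or.inr hu)
        have hne' : u ≠ v := by rintro rfl; exact hG _ hu
        have h2 := hm.isHom_left hu
        rw [← hne u hne', e] at h2
        exact ⟨e ▸ hα hu, h2⟩
      · rintro ⟨u, hu⟩
        have e := hh u (Or.inl hu)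
        have hne' : u ≠ v := by rintro rfl; exact hG _ hu
        have h2 := hm.isHom_left hu
        rw [← hne u hne', e] at h2
        exact ⟨e ▸ hα hu, h2⟩
    · rw [hsu v hv, hne v hv]
      exact ih

/-- Free group elements along a walk in `G`. -/
lemma MR.topological_walk (hG : G.Loopless) (h : MR G H α β s) : ∀ (l : List V) (u v : V),
    IsWalk G u v l → s v = (gam (l.map α))⁻¹ * s u * gam (l.map β)
  | [], _, _, hl => absurd rfl hl.1
  | [x], u, v, hl => by
    obtain ⟨-, h1, h2, -⟩ := hl
    simp at h1 h2
    subst h1 h2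
    simp
  | x :: y :: t, u, v, hl => by
    obtain ⟨-, h1, h2, h3⟩ := hl
    simp at h1
    subst h1
    have h3' := List.isChain_cons_cons.1 h3
    have := MR.topological_walk hG h (y :: t) y v ⟨by simp, by simp, by simpa using h2, h3'.2⟩
    rw [this, h.topological hG h3'.1]
    simp [mul_assoc]

lemma MR.exists_seq (q : V) (h : MR G H α β s) : ∃ (rest : List (V → X)) (Sq : List X),
    IsRecolSeq G H (α :: rest) ∧ (α :: rest).getLast? = some β ∧ MonoNbhd G (α :: rest) ∧
      VWalk G q (α :: rest) Sq ∧ Sq.head? = some (α q) ∧ gam Sq = s q := by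
  induction h with
  | @refl α s hα hs =>
    refine ⟨[], [α q], ⟨by simp, by simpa using hα, List.isChain_singleton _⟩, by simp,
      List.isChain_singleton _, .single _, by simp, by simp [hs]⟩
  | @step α α' β s s' x k hα hx hne hh hm hsv hsu ih =>
    obtain ⟨rest, Sq, ⟨h1, h2, h3⟩, h4, h5, h6, h7, h8⟩ := ih
    have huniq : ∀ u, α u ≠ α' u → u = x := fun u hu => by
      by_contra hux
      exact hu (hne u hux)
    obtain ⟨t, rfl⟩ : ∃ t, Sq = α' q :: t := by
      cases Sq with
      | nil => simp at h7
      | cons y t => simp at h7; exact ⟨t, by rw [h7]⟩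
    have hseq : IsRecolSeq G H (α :: α' :: rest) :=
      ⟨by simp, by
        intro σ hσ
        rcases List.mem_cons.1 hσ with rfl | hσ
        · exact hα
        · exact h2 σ hσ, List.isChain_cons_cons.2 ⟨⟨x, hx, huniq⟩, h3⟩⟩
    have hmono : MonoNbhd G (α :: α' :: rest) := by
      refine List.isChain_cons_cons.2 ⟨?_, h5⟩
      intro v hv
      rw [huniq v hv]
      exact ⟨k, hh⟩
    by_cases hq : q = x
    · subst hq
      refine ⟨α' :: rest, α q :: k :: α' q :: t, hseq, by simpa using h4, hmono,
        .move k hx hh h6, by simp, ?_⟩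
      rw [hsv, ← h8]
      simp [mul_assoc]
    · refine ⟨α' :: rest, α' q :: t, hseq, by simpa using h4, hmono,
        .stay (hne q hq) h6, by simp [hne q hq], ?_⟩
      rw [hsu q hq, h8]

lemma MR.of_seq (hnb : ∀ v, ∃ w, G.UAdj v w) (q : V) : ∀ (rest : List (V → X)) (α : V → X)
    (Sq : List X), IsRecolSeq G H (α :: rest) → (α :: rest).getLast? = some β →
    MonoNbhd G (α :: rest) → VWalk G q (α :: rest) Sq →
    Sq.head? = some (α q) ∧ ∃ s, MR G H α β s ∧ s q = gam Sq
  | [], α, Sq, h1, h2, h3, h4 => by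
    cases h4
    simp at h2
    subst h2
    exact ⟨by simp, fun _ => 1, .refl (h1.2.1 α (by simp)) fun _ => rfl, by simp⟩
  | α' :: rest, α, Sq, ⟨h11, h12, h13⟩, h2, h3, h4 => by
    classical
    have h13' := List.isChain_cons_cons.1 h13
    have h3' := List.isChain_cons_cons.1 h3
    obtain ⟨x, hx, huniq⟩ := h13'.1
    obtain ⟨k, hk⟩ := h3'.1 x hx
    have hne : ∀ u, u ≠ x → α u = α' u := fun u hu => by
      by_contra h
      exact hu (huniq u h)
    have ih := MR.of_seq hnb q rest α'
    have hs' : IsRecolSeq G H (α' :: rest) :=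
      ⟨by simp, fun σ hσ => h12 σ (List.mem_cons_of_mem _ hσ), h13'.2⟩
    have key : ∀ s, MR G H α' β s → MR G H α β
        (fun u => if u = x then edge (α x) k * edge k (α' x) * s x else s u) := fun s hs =>
      .step x k (h12 α (by simp)) hx hne hk hs (by simp) (fun u hu => by simp [hu])
    cases h4 with
    | stay he hw =>
      obtain ⟨h5, s, hs, h6⟩ := ih _ hs' (by simpa using h2) h3'.2 hw
      refine ⟨by rw [h5, he], _, key s hs, ?_⟩
      have : q ≠ x := by rintro rfl; exact hx he
      simp [this, h6]
    | @move _ _ _ l k' hqq hk' hw =>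
      obtain ⟨h5, s, hs, h6⟩ := ih _ hs' (by simpa using h2) h3'.2 hw
      refine ⟨by simp, _, key s hs, ?_⟩
      have hq : q = x := huniq q hqq
      subst hq
      obtain ⟨w, hw'⟩ := hnb q
      have hkk : k = k' := by rw [← hk w hw', hk' w hw']
      subst hkk
      obtain ⟨t, rfl⟩ : ∃ t, l = α' q :: t := by
        cases l with
        | nil => simp at h5
        | cons y t => simp at h5; exact ⟨t, by rw [h5]⟩
      simp [h6, mul_assoc]

lemma mRealizable_iff (hnb : ∀ v, ∃ w, G.UAdj v w) (q : V) {Q : List X}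
    (hQ : Q.head? = some (α q)) :
    MRealizable G H α β q Q ↔ ∃ s, MR G H α β s ∧ s q = gam Q := by
  constructor
  · rintro ⟨σs, Sq, h1, h2, h3, h4, h5, h6⟩
    obtain ⟨rest, rfl⟩ : ∃ rest, σs = α :: rest := by
      cases σs with
      | nil => simp at h2
      | cons y t => simp at h2; exact ⟨t, by rw [h2]⟩
    obtain ⟨-, s, hs, h7⟩ := MR.of_seq hnb q rest α Sq h1 h3 h4 h5
    exact ⟨s, hs, by rw [h7, h6.gam_eq]⟩
  · rintro ⟨s, hs, h⟩
    obtain ⟨rest, Sq, h1, h2, h3, h4, h5, h6⟩ := hs.exists_seq q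
    refine ⟨α :: rest, Sq, h1, by simp, h2, h3, h4, piEq_of_gam ?_ ?_ ?_⟩
    · rintro rfl; simp at h5
    · rw [h5, hQ]
    · rw [h6, h]

end

/-! ### Realizing compatible systems of walks -/

lemma exists_snoc {l : List X} (hl : IsReduced l) {z : X} (hz : l.getLast? = some z) (y : X) :
    ∃ N, IsReduced N ∧ gam N = gam l * edge z y ∧ (N = l ∨ N = l ++ [y] ∨ N = l.dropLast) := by
  obtain ⟨p, rfl⟩ := List.getLast?_eq_some_iff.1 hz
  have e : (p ++ [z]).reverse = z :: p.reverse := by simp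
  refine ⟨(rcons y (p ++ [z]).reverse).reverse, (isReduced_rcons _ hl.reverse).reverse, ?_, ?_⟩
  · rw [gam_reverse, e, gam_rcons, ← e, gam_reverse]
    simp
  · rw [e]
    rcases rcons_cases y z p.reverse with ⟨_, e⟩ | ⟨_, t', h, e⟩ | ⟨h1, h2, e⟩ <;> rw [e]
    · left; simp
    · right; right; rw [← h]; simp
    · right; left; simp

section

variable {G : Dgraph V} {H : Dgraph X} {α β : V → X}

lemma exists_movable [Finite V] [Finite X] (hH : H.Loopless) (hα : IsHom G H α)
    {S : V → List X} {f : V → FreeGroup (X × X)} (hred : ∀ v, IsReduced (S v))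
    (hhead : ∀ v, (S v).head? = some (α v)) (hlast : ∀ v, (S v).getLast? = some (β v))
    (hodd : ∀ v, Odd (S v).length)
    (hco : ∀ u v, G.UAdj u v →
      gam (S v) = edge (α v) (α u) * gam (S u) * edge (β u) (β v))
    (hf : ∀ u v, G.UAdj u v → f u * edge (α u) (α v) = f v)
    (hne : ∃ v, (S v).length ≠ 1) :
    ∃ v h b t, S v = α v :: h :: b :: t ∧ ∀ w, G.UAdj v w → α w = h := by
  classical
  obtain ⟨v₁, hv₁⟩ := hne
  have : Nonempty V := ⟨v₁⟩
  obtain ⟨vm, hvm⟩ := Finite.exists_max fun v => (S v).length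
  have hM : 3 ≤ (S vm).length := by
    have h1 := hvm v₁
    obtain ⟨k, hk⟩ := hodd v₁
    obtain ⟨k', hk'⟩ := hodd vm
    omega
  by_contra hcon
  push Not at hcon
  have hlong : ∀ v, (S v).length = (S vm).length → ∃ h b t, S v = α v :: h :: b :: t := by
    intro v hv
    have h1 := hhead v
    rcases hS : S v with _ | ⟨a, _ | ⟨h, _ | ⟨b, t⟩⟩⟩
    · simp [hS] at hv; omega
    · simp [hS] at hv; omega
    · simp [hS] at hv; omega
    · simp [hS] at h1
      exact ⟨h, b, t, by rw [h1]⟩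
  have chain : ∀ n : ℕ, ∃ (v v₀ : V) (h h₀ : X) (t L : List X), S v = α v :: h :: t ∧
      (S v).length = (S vm).length ∧ IsReduced (α v :: h :: L) ∧ L.length = n ∧
      f v * gam (α v :: h :: L) = f v₀ * edge (α v₀) h₀ := by
    intro n
    induction n with
    | zero =>
      obtain ⟨h, b, t, ht⟩ := hlong vm rfl
      refine ⟨vm, vm, h, h, b :: t, [], ht, rfl, ?_, rfl, by simp⟩
      have := hred vm
      rw [ht] at this
      exact IsReduced.of_append (p := []) (s := b :: t) (by simpa using this)
    | succ n ih =>
      obtain ⟨v, v₀, h, h₀, t, L, hS, hlen, hL, hLn, hfL⟩ := ih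
      obtain ⟨h', b, t', hS'⟩ := hlong v hlen
      obtain ⟨rfl, rfl⟩ : h = h' ∧ t = b :: t' := by
        rw [hS] at hS'
        simpa using hS'
      obtain ⟨w, hw, hwh⟩ := hcon v h b t' hS
      have hwv : α w ≠ α v := fun e => by
        have := hα.uadj hw
        rw [e] at this
        exact hH _ (this.elim id id)
      have hl1 : IsReduced (α w :: S v) := by
        have := hred v
        rw [hS] at this ⊢
        rw [isReduced_cons_cons]
        exact ⟨hwv, by simpa using hwh.symm, this⟩
      have hl2 : (α w :: S v).getLast? = some (β v) := by
        rw [← hlast v, hS]; simp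
      obtain ⟨N, hN1, hN2, hN3⟩ := exists_snoc hl1 hl2 (β w)
      have hhN : N.head? = some (α w) := by
        rcases hN3 with rfl | rfl | rfl <;> simp [hS]
      have hSw : S w = N := by
        refine (hred w).eq_of_gam hN1 (by rw [hhead, hhN]) ?_
        rw [hco v w hw, hN2, hS]
        simp
      have hle : (S w).length ≤ (S vm).length := hvm w
      rw [hSw] at hle
      have hNl : N = (α w :: S v).dropLast := by
        rcases hN3 with h | h | h
        · rw [h] at hle; simp at hle; omega
        · rw [h] at hle; simp at hle; omega
        · exact h
      refine ⟨w, v₀, α v, h₀, h :: (b :: t').dropLast, h :: L, ?_, ?_, ?_, ?_, ?_⟩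
      · rw [hSw, hNl, hS]; simp
      · rw [hSw, hNl, ← hlen]; simp
      · rw [isReduced_cons_cons]
        exact ⟨hwv, by simpa using hwh.symm, hL⟩
      · simp [hLn]
      · rw [← hfL, gam_cons_cons, ← hf w v hw.symm]
        simp [mul_assoc]
  obtain ⟨B, hB⟩ := (Set.finite_range fun x : V × V × X =>
    ((f x.1)⁻¹ * (f x.2.1 * edge (α x.2.1) x.2.2)).norm).bddAbove
  obtain ⟨v, v₀, h, h₀, t, L, -, -, hL, hLn, hfL⟩ := chain B
  have h1 := norm_gam hL
  have h2 : gam (α v :: h :: L) = (f v)⁻¹ * (f v₀ * edge (α v₀) h₀) := by rw [← hfL]; simp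
  have h3 := hB ⟨(v, v₀, h₀), rfl⟩
  simp only at h3
  rw [← h2, h1] at h3
  simp [hLn] at h3
  omega

/-- A compatible system of reduced zigzag walks of even length between two colorings, the second
of which lifts to the universal cover, is realized by a recoloring sequence. -/
lemma MR.of_system [Fintype V] [Finite X] (hG : G.Loopless) (hH : H.Loopless)
    {f : V → FreeGroup (X × X)} (hf : ∀ u v, G.UAdj u v → f u * edge (β u) (β v) = f v)
    (n : ℕ) : ∀ (α : V → X) (S : V → List X), IsHom G H α → (∀ v, IsReduced (S v)) →
    (∀ v, (S v).head? = some (α v)) → (∀ v, (S v).getLast? = some (β v)) →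
    (∀ v, Odd (S v).length) → (∀ v, ZG H (TypeIN G v) (TypeOUT G v) (S v)) →
    (∀ u v, G.UAdj u v → gam (S v) = edge (α v) (α u) * gam (S u) * edge (β u) (β v)) →
    ∑ v, (S v).length = n → MR G H α β (fun v => gam (S v)) := by
  classical
  induction n using Nat.strong_induction_on with
  | _ n ih =>
  intro α S hα hred hhead hlast hodd hzg hco hn
  by_cases hne : ∃ v, (S v).length ≠ 1
  · obtain ⟨v, h, b, t, hS, hh⟩ := exists_movable (f := fun v => f v * (gam (S v))⁻¹)
      hH hα hred hhead hlast hodd hco (by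
        intro u v huv
        rw [hco u v huv, ← hf u v huv]
        simp [mul_assoc]) hne
    have hz := hzg v
    have hr := hred v
    rw [hS] at hz hr
    have hab : α v ≠ b := by
      have := ((isReduced_cons_cons _ _ _).1 hr).2.1
      simpa using this.symm
    set α' := Function.update α v b with hα'
    set S' := Function.update S v (b :: t) with hS'
    have hα'u : ∀ u, u ≠ v → α' u = α u := fun u hu => by simp [hα', hu]
    have hα'v : α' v = b := by simp [hα']
    have hS'u : ∀ u, u ≠ v → S' u = S u := fun u hu => by simp [hS', hu]
    have hS'v : S' v = b :: t := by simp [hS']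
    have hhom : IsHom G H α' := by
      intro x y hxy
      have hxy' : x ≠ y := by rintro rfl; exact hG _ hxy
      by_cases hx : x = v
      · subst hx
        rw [hα'v, hα'u y hxy'.symm, hh y (Or.inl hxy)]
        exact hz.2.1.1 ⟨y, hxy⟩
      · by_cases hy : y = v
        · subst hy
          rw [hα'v, hα'u x hx, hh x (Or.inr hxy)]
          exact hz.2.1.2 ⟨x, hxy⟩
        · rw [hα'u x hx, hα'u y hy]; exact hα hxy
    have hlt : ∑ u, (S' u).length < n := by
      rw [← hn]
      refine Finset.sum_lt_sum (fun u _ => ?_) ⟨v, Finset.mem_univ _, ?_⟩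
      · by_cases hu : u = v
        · subst hu; rw [hS'v, hS]; simp
        · rw [hS'u u hu]
      · rw [hS'v, hS]; simp
    have key := ih _ hlt α' S' hhom ?_ ?_ ?_ ?_ ?_ ?_ rfl
    · refine .step v h hα (by rw [hα'v]; exact hab) (fun u hu => (hα'u u hu).symm) hh key ?_ ?_
      · simp only [hα'v, hS'v, hS]; simp [mul_assoc]
      · intro u hu; simp only [hS'u u hu]
    · intro u
      by_cases hu : u = v
      · subst hu; rw [hS'v]; exact hr.tail.tail
      · rw [hS'u u hu]; exact hred u
    · intro u
      by_cases hu : u = v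
      · subst hu; rw [hS'v, hα'v]; simp
      · rw [hS'u u hu, hα'u u hu]; exact hhead u
    · intro u
      by_cases hu : u = v
      · subst hu
        have := hlast u
        rw [hS] at this
        rw [hS'v]; simpa using this
      · rw [hS'u u hu]; exact hlast u
    · intro u
      by_cases hu : u = v
      · subst hu
        have := hodd u
        rw [hS] at this
        rw [hS'v]
        simp [Nat.odd_add_one] at this ⊢
        exact this
      · rw [hS'u u hu]; exact hodd u
    · intro u
      by_cases hu : u = v
      · subst hu; rw [hS'v]; exact hz.2.2
      · rw [hS'u u hu]; exact hzg u
    · intro x y hxy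
      have hxy' := hxy.ne hG
      have h0 := hco x y hxy
      by_cases hx : x = v
      · subst hx
        rw [hα'u y hxy'.symm, hS'u y hxy'.symm, hα'v, hS'v, h0, hS, hh y hxy]
        simp [mul_assoc]
      · by_cases hy : y = v
        · subst hy
          rw [hS, hh x hxy.symm] at h0
          rw [hα'u x hx, hS'u x hx, hα'v, hS'v, hh x hxy.symm]
          have h1 := congrArg (fun w => edge b h * (edge h (α y) * w)) h0
          simpa [mul_assoc] using h1
        · rw [hα'u x hx, hα'u y hy, hS'u x hx, hS'u y hy, h0]
  · push Not at hne
    have hS : ∀ v, S v = [α v] := by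
      intro v
      obtain ⟨x, hx⟩ := List.length_eq_one_iff.1 (hne v)
      have := hhead v
      rw [hx] at this ⊢
      simpa using this
    have : α = β := by
      funext v
      have := hlast v
      rw [hS] at this
      simpa using this
    subst this
    exact .refl hα (by simp [hS])

end

/-! ### Powers of a closed walk -/

lemma head?_wcomp {l l' : List X} {x : X} (h : l.getLast? = some x) :
    (wcomp l l').head? = l.head? := by
  cases l with
  | nil => simp at h
  | cons a l => simp [wcomp]

lemma getLast?_wcomp {l l' : List X} {x : X} (h : l.getLast? = some x)
    (h' : l'.head? = some x) : (wcomp l l').getLast? = l'.getLast? := by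
  cases l' with
  | nil => simp at h'
  | cons a l' =>
    simp only [List.head?_cons, Option.some.injEq] at h'
    subst h'
    cases l' with
    | nil => simpa [wcomp] using h
    | cons b l' => simp [wcomp, List.getLast?_cons]

lemma witer_spec {R : List X} {a : X} (h : R.head? = some a) (h' : R.getLast? = some a) (n : ℕ) :
    (witer R a n).head? = some a ∧ (witer R a n).getLast? = some a ∧
      gam (witer R a n) = gam R ^ n := by
  induction n with
  | zero => simp [witer]
  | succ n ih =>
    obtain ⟨h1, h2, h3⟩ := ih
    refine ⟨?_, ?_, ?_⟩
    · rw [witer, head?_wcomp h', h]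
    · rw [witer, getLast?_wcomp h' h1, h2]
    · rw [witer, gam_wcomp _ _ a h' h1, h3, pow_succ']

lemma zpowWalk_spec {R : List X} {a : X} (h : R.head? = some a) (h' : R.getLast? = some a)
    (n : ℤ) : (zpowWalk R a n).head? = some a ∧ (zpowWalk R a n).getLast? = some a ∧
      gam (zpowWalk R a n) = gam R ^ n := by
  unfold zpowWalk
  split_ifs with hn
  · lift n to ℕ using hn
    simpa using witer_spec h h' n
  · obtain ⟨m, rfl⟩ : ∃ m : ℕ, n = -(m : ℤ) := ⟨(-n).toNat, by omega⟩
    have := witer_spec (R := R.reverse) (a := a) (by simpa using h') (by simpa using h) m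
    simpa [gam_reverse] using this

section

variable {G : Dgraph V} {H : Dgraph X} {α β : V → X}

lemma type_or_of_uadj (hnb : ∀ v, ∃ w, G.UAdj v w) (v : V) : TypeIN G v ∨ TypeOUT G v := by
  obtain ⟨w, h | h⟩ := hnb v
  · exact Or.inr ⟨w, h⟩
  · exact Or.inl ⟨w, h⟩

/-- A walk whose free group element is that of a reconfiguration is realizable. -/
lemma mem_mRealSet (hG : G.Loopless) (hH : H.Loopless) (hnb : ∀ v, ∃ w, G.UAdj v w) {q : V}
    {Q : List X} : Q ∈ MRealSet G H α β q ↔ IsReduced Q ∧ Q.head? = some (α q) ∧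
      ∃ s, MR G H α β s ∧ s q = gam Q := by
  constructor
  · rintro ⟨h1, h2, h3⟩
    exact ⟨h2, h1.2.1, (mRealizable_iff hnb q h1.2.1).1 h3⟩
  · rintro ⟨h1, h2, s, hs, hsq⟩
    obtain ⟨l, l1, l2, l3, -, l5, l6⟩ := (hs.zz hG q).exists_list hH (type_or_of_uadj hnb q)
    obtain rfl : l = Q := l1.eq_of_gam h1 (by rw [l2, h2]) (by rw [l6, hsq])
    exact ⟨l5.isWalk (type_or_of_uadj hnb q) l2 l3, h1, (mRealizable_iff hnb q h2).2 ⟨s, hs, hsq⟩⟩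

/-- The elements by which closed reconfiguration sequences move `q`. -/
def closedGroup (hG : G.Loopless) (hα : IsHom G H α) (q : V) : Subgroup (FreeGroup (X × X)) where
  carrier := {w | ∃ s, MR G H α α s ∧ s q = w}
  one_mem' := ⟨fun _ => 1, .refl hα fun _ => rfl, rfl⟩
  mul_mem' := by
    rintro _ _ ⟨s, hs, rfl⟩ ⟨s', hs', rfl⟩
    exact ⟨_, hs.trans hs', rfl⟩
  inv_mem' := by
    rintro _ ⟨s, hs, rfl⟩
    exact ⟨_, hs.symm hG, rfl⟩

lemma mRealSet_of_cyclic (hG : G.Loopless) (hH : H.Loopless) (hnb : ∀ v, ∃ w, G.UAdj v w)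
    (hα : IsHom G H α) {q : V} {r : FreeGroup (X × X)}
    (hr : closedGroup hG hα q = Subgroup.zpowers r) :
    MRealSet G H α β q = ∅ ∨
      ∃ R P : List X, IsWalk H (α q) (α q) R ∧ IsWalk H (α q) (β q) P ∧
        MRealSet G H α β q =
          {Q | IsReduced Q ∧ ∃ n : ℤ, PiEq (wcomp (zpowWalk R (α q) n) P) Q} := by
  by_cases he : ∃ s, MR G H α β s
  · right
    obtain ⟨s₀, hs₀⟩ := he
    have hio := type_or_of_uadj hnb q
    obtain ⟨s₁, hs₁, rfl⟩ : r ∈ closedGroup hG hα q := hr ▸ Subgroup.mem_zpowers r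
    obtain ⟨P, -, P2, P3, -, P5, P6⟩ := (hs₀.zz hG q).exists_list hH hio
    obtain ⟨R, -, R2, R3, -, R5, R6⟩ := (hs₁.zz hG q).exists_list hH hio
    refine ⟨R, P, R5.isWalk hio R2 R3, P5.isWalk hio P2 P3, ?_⟩
    have hw : ∀ n : ℤ, (wcomp (zpowWalk R (α q) n) P).head? = some (α q) ∧
        gam (wcomp (zpowWalk R (α q) n) P) = s₁ q ^ n * s₀ q := by
      intro n
      obtain ⟨h1, h2, h3⟩ := zpowWalk_spec R2 R3 n
      rw [head?_wcomp h2, gam_wcomp _ _ _ h2 P2, h3, R6, P6]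
      exact ⟨h1, rfl⟩
    ext Q
    rw [mem_mRealSet hG hH hnb]
    constructor
    · rintro ⟨h1, h2, s, hs, hsq⟩
      refine ⟨h1, ?_⟩
      have : s q * (s₀ q)⁻¹ ∈ closedGroup hG hα q := ⟨_, hs.trans (hs₀.symm hG), rfl⟩
      rw [hr, Subgroup.mem_zpowers_iff] at this
      obtain ⟨n, hn⟩ := this
      obtain ⟨w1, w2⟩ := hw n
      refine ⟨n, piEq_of_gam (fun e => by simp [e] at w1) (by rw [w1, h2]) ?_⟩
      rw [w2, hn, ← hsq]
      simp
    · rintro ⟨h1, n, hn⟩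
      obtain ⟨w1, w2⟩ := hw n
      obtain ⟨s, hs, hsq⟩ : s₁ q ^ n ∈ closedGroup hG hα q :=
        hr ▸ Subgroup.zpow_mem_zpowers (s₁ q) n
      refine ⟨h1, by rw [← hn.head?_eq, w1], _, hs.trans hs₀, ?_⟩
      rw [← hn.gam_eq, w2, hsq]
  · left
    ext Q
    rw [mem_mRealSet hG hH hnb]
    simp only [Set.mem_empty_iff_false, iff_false]
    rintro ⟨-, -, s, hs, -⟩
    exact he ⟨s, hs⟩

/-- If some closed walk is mapped to a nontrivial element, closed reconfigurations form a cyclic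
group. -/
lemma closedGroup_cyclic_of_walk (hG : G.Loopless) (hα : IsHom G H α) {q : V} {C : List V}
    (hC : IsWalk G q q C) (hne : gam (C.map α) ≠ 1) :
    ∃ r, closedGroup hG hα q = Subgroup.zpowers r := by
  refine exists_zpowers_of_centralizes _ hne _ ?_
  rintro _ ⟨s, hs, rfl⟩
  have := hs.topological_walk hG C q q hC
  calc s q * gam (C.map α) = gam (C.map α) * ((gam (C.map α))⁻¹ * s q * gam (C.map α)) := by
        simp [mul_assoc]
    _ = _ := by rw [← this]

end

/-! ### Reaching a two-colored homomorphism -/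

lemma gam_cons_of_head {l : List X} {y : X} (x : X) (h : l.head? = some y) :
    gam (x :: l) = edge x y * gam l := by
  cases l with
  | nil => simp at h
  | cons z t =>
    simp only [List.head?_cons, Option.some.injEq] at h
    simp [h]

/-- Prepending a walk to a long reduced walk and reducing only affects an initial segment. -/
lemma exists_prefix {A B : List X} {m m' : X} (h : IsReduced (A ++ m :: m' :: B)) :
    ∀ p : List X, p.length ≤ A.length → ∃ A', IsReduced (A' ++ m :: m' :: B) ∧
      A.length ≤ A'.length + p.length ∧ (A' ++ [m]).head? = (p ++ A ++ [m]).head? ∧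
      gam (A' ++ [m]) = gam (p ++ A ++ [m])
  | [], _ => ⟨A, h, by simp, rfl, rfl⟩
  | x :: p, hp => by
    simp only [List.length_cons] at hp
    obtain ⟨A', h1, h2, h3, h4⟩ := exists_prefix h p (by omega)
    obtain ⟨y, t, rfl⟩ : ∃ y t, A' = y :: t := by
      cases A' with
      | nil => simp at h2; omega
      | cons y t => exact ⟨y, t, rfl⟩
    have hg : gam (x :: p ++ A ++ [m]) = edge x y * gam (p ++ A ++ [m]) := by
      rw [List.cons_append, List.cons_append, gam_cons_of_head x (by rw [← h3]; rfl)]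
    have hr := isReduced_rcons x h1
    simp only [List.length_cons] at h2
    rw [hg, ← h4]
    rcases rcons_cases x y (t ++ m :: m' :: B) with ⟨rfl, e⟩ | ⟨_, t', ht', e⟩ | ⟨_, _, e⟩
    · exact ⟨x :: t, h1, by simp; omega, rfl, by simp⟩
    · rw [List.cons_append, e] at hr
      rcases t with _ | ⟨z, t⟩
      · simp only [List.nil_append, List.cons.injEq] at ht'
        obtain ⟨rfl, rfl⟩ := ht'
        exact ⟨[], hr, by simp at h2 ⊢; omega, rfl, by simp⟩
      · simp only [List.cons_append, List.cons.injEq] at ht'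
        obtain ⟨rfl, rfl⟩ := ht'
        exact ⟨z :: t, hr, by simp at h2 ⊢; omega, rfl, by simp⟩
    · rw [List.cons_append, e] at hr
      exact ⟨x :: y :: t, hr, by simp; omega, rfl, by simp⟩

/-- Conjugating a long reduced closed walk by a short walk preserves its middle edge. -/
lemma exists_middle {A B p : List X} {m m' a b : X} (h : IsReduced (A ++ m :: m' :: B))
    (hA : p.length ≤ A.length) (hB : p.length ≤ B.length)
    (hh : (A ++ m :: m' :: B).head? = some b) (hl : (A ++ m :: m' :: B).getLast? = some b)
    (hp : p.head? = some a) (hp' : p.getLast? = some b) :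
    ∃ A' B', IsReduced (A' ++ m :: m' :: B') ∧ (A' ++ m :: m' :: B').head? = some a ∧
      gam (A' ++ [m]) = gam p * gam (A ++ [m]) ∧
      gam (A' ++ m :: m' :: B') = gam p * gam (A ++ m :: m' :: B) * (gam p)⁻¹ := by
  obtain ⟨p₀, rfl⟩ := List.getLast?_eq_some_iff.1 hp'
  obtain ⟨A', h1, -, h3, h4⟩ := exists_prefix h _ hA
  have h1' := h1.reverse
  simp only [List.reverse_append, List.reverse_cons, List.append_assoc, List.nil_append,
    List.cons_append] at h1'
  obtain ⟨B', k1, -, k3, k4⟩ := exists_prefix h1' (p₀ ++ [b]) (by simpa using hB)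
  have join : ∀ l : List X, l.head? = some b → gam (p₀ ++ [b] ++ l) = gam (p₀ ++ [b]) * gam l := by
    intro l hl
    cases l with
    | nil => simp at hl
    | cons c l =>
      simp only [List.head?_cons, Option.some.injEq] at hl
      subst hl
      rw [List.append_assoc, List.singleton_append, gam_append]
      simp
  have hA1 : (A ++ [m]).head? = some b := by
    cases A <;> simpa using hh
  have hB1 : (B.reverse ++ [m']).head? = some b := by
    rw [← hl, ← List.reverse_cons, List.head?_reverse]
    simp [List.getLast?_cons]
  have e1 : gam (A' ++ [m]) = gam (p₀ ++ [b]) * gam (A ++ [m]) := by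
    rw [h4, List.append_assoc, join _ hA1]
  have e2 : gam (B' ++ [m']) = gam (p₀ ++ [b]) * gam (B.reverse ++ [m']) := by
    rw [k4, List.append_assoc, join _ hB1]
  have split : ∀ A B : List X, gam (A ++ m :: m' :: B) =
      gam (A ++ [m]) * edge m m' * (gam (B.reverse ++ [m']))⁻¹ := by
    intro A B
    rw [gam_append, gam_cons_cons, ← gam_reverse]
    simp [mul_assoc]
  refine ⟨A', B'.reverse, by simpa using k1.reverse, ?_, e1, ?_⟩
  · have : (A' ++ m :: m' :: B'.reverse).head? = (A' ++ [m]).head? := by cases A' <;> simp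
    rw [this, h3, ← hp]
    cases p₀ <;> simp
  · rw [split, split, List.reverse_reverse, e1, e2]
    simp [mul_assoc]

section

variable {G : Dgraph V} {H : Dgraph X} {α β : V → X}

/-- If all closed walks are mapped to the identity, then `α` lifts to the universal cover. -/
lemma potential {q : V} (hC : ∀ C, IsWalk G q q C → gam (C.map α) = 1) {W : V → List V}
    (hW : ∀ v, IsWalk G q v (W v)) {u v : V} (huv : G.UAdj u v) :
    gam ((W u).map α) * edge (α u) (α v) = gam ((W v).map α) := by
  obtain ⟨hn, h1, h2, h3⟩ := hW u
  obtain ⟨kn, k1, k2, k3⟩ := hW v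
  obtain ⟨p, hp⟩ := List.getLast?_eq_some_iff.1 h2
  obtain ⟨p', hp'⟩ := List.getLast?_eq_some_iff.1 k2
  have hwalk : IsWalk G q q (W u ++ (W v).reverse) := by
    refine ⟨by simp [hn], by rw [List.head?_append, h1]; rfl, ?_, ?_⟩
    · rw [List.getLast?_append]
      simp [k1]
    · refine List.isChain_append.2 ⟨h3, ?_, ?_⟩
      · exact List.isChain_reverse.2 (k3.imp fun _ _ h => h.symm)
      · intro a ha b hb
        rw [h2] at ha
        rw [List.head?_reverse, k2] at hb
        simp only [Option.mem_def, Option.some.injEq] at ha hb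
        subst ha hb
        exact huv
  have := hC _ hwalk
  rw [hp] at this
  have e : (W v).reverse.map α = α v :: p'.reverse.map α := by rw [hp']; simp
  rw [List.map_append, e, List.map_append, List.map_singleton, List.append_assoc,
    List.singleton_append, gam_append, gam_cons_cons, ← e, List.map_reverse, gam_reverse] at this
  rw [hp, List.map_append, List.map_singleton, ← mul_inv_eq_one, mul_assoc]
  exact this

lemma exists_long [Finite X] (hG : G.Loopless) (hH : H.Loopless) (hα : IsHom G H α) {q : V}
    (hio : TypeIN G q ∨ TypeOUT G q) {y : FreeGroup (X × X)} (hy : y ∈ closedGroup hG hα q)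
    (hne : y ≠ 1) (N : ℕ) : ∃ s l, MR G H α α s ∧ IsReduced l ∧ l.head? = some (α q) ∧
      l.getLast? = some (α q) ∧ gam l = s q ∧ N ≤ l.length := by
  have hinj := injective_pow_iff_not_isOfFinOrder.2 (not_isOfFinOrder_of_isMulTorsionFree hne)
  have hl : ∀ n : ℕ, ∃ s l, MR G H α α s ∧ IsReduced l ∧ l.head? = some (α q) ∧
      l.getLast? = some (α q) ∧ gam l = s q ∧ s q = y ^ n := by
    intro n
    obtain ⟨s, hs, hsq⟩ := (closedGroup hG hα q).pow_mem hy n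
    obtain ⟨l, h1, h2, h3, -, -, h6⟩ := (hs.zz hG q).exists_list hH hio
    exact ⟨s, l, hs, h1, h2, h3, h6, hsq⟩
  choose s l h1 h2 h3 h4 h5 h6 using hl
  by_contra hcon
  push Not at hcon
  refine Set.infinite_of_injective_forall_mem (f := l) (s := {l | l.length < N}) ?_ ?_
    (List.finite_length_lt X N)
  · intro a b hab
    refine hinj ?_
    simp only
    rw [← h6, ← h6, ← h5, ← h5, hab]
  · exact fun n => hcon (s n) (l n) (h1 n) (h2 n) (h3 n) (h4 n) (h5 n)

/-- If all closed walks are mapped to the identity and some closed reconfiguration moves `q` along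
a nontrivial walk, then `α` can be reconfigured to a homomorphism with only two colors. -/
lemma exists_twoColor [Fintype V] [Finite X] (hG : G.Loopless) (hH : H.Loopless)
    (hconn : G.WConn) (hnb : ∀ v, ∃ w, G.UAdj v w) (hα : IsHom G H α) {q : V}
    (hC : ∀ C, IsWalk G q q C → gam (C.map α) = 1) {y : FreeGroup (X × X)}
    (hy : y ∈ closedGroup hG hα q) (hne : y ≠ 1) :
    ∃ m m' κ s, MR G H α κ s ∧ ∀ v, κ v = m ∨ κ v = m' := by
  classical
  choose W hW using hconn q
  have hpot := fun u v (huv : G.UAdj u v) => potential hC hW huv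
  obtain ⟨M, hM⟩ := (Set.finite_range fun v => (W v).length).bddAbove
  have hM : ∀ v, (W v).length ≤ M := fun v => hM ⟨v, rfl⟩
  obtain ⟨s, l, hs, l1, l2, l3, l4, l5⟩ :=
    exists_long hG hH hα (type_or_of_uadj hnb q) hy hne (2 * M + 2)
  obtain ⟨A, m, m', B, rfl, hAl, hBl⟩ : ∃ A m m' B, l = A ++ m :: m' :: B ∧ M ≤ A.length ∧
      M ≤ B.length := by
    have e := (List.take_append_drop M l).symm
    have hd : (l.drop M).length = l.length - M := List.length_drop
    rcases hdl : l.drop M with _ | ⟨m, _ | ⟨m', B⟩⟩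
    · rw [hdl] at hd; simp at hd; omega
    · rw [hdl] at hd; simp at hd; omega
    · rw [hdl] at hd e
      simp only [List.length_cons] at hd
      exact ⟨_, m, m', B, e, by rw [List.length_take]; omega, by omega⟩
  have hmid := fun v => exists_middle (p := (W v).reverse.map α) (a := α v) l1
    (by simpa using (hM v).trans hAl) (by simpa using (hM v).trans hBl) l2 l3
    (by simp [(hW v).2.2.1]) (by simp [(hW v).2.1])
  choose A' B' a1 a2 a3 a4 using hmid
  have hgp : ∀ v, gam ((W v).reverse.map α) = (gam ((W v).map α))⁻¹ := by
    intro v; rw [List.map_reverse, gam_reverse]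
  have hzg : ∀ v, ZG H (TypeIN G v) (TypeOUT G v) (A' v ++ m :: m' :: B' v) := by
    intro v
    obtain ⟨L, t1, t2, -, -, t5, t6⟩ := (hs.zz hG v).exists_list hH (type_or_of_uadj hnb v)
    have : L = A' v ++ m :: m' :: B' v := by
      refine t1.eq_of_gam (a1 v) (by rw [t2, a2]) ?_
      rw [t6, a4, l4, hgp, hs.topological_walk hG (W v) q v (hW v), inv_inv]
    rwa [← this]
  have hr1 : ∀ v, IsReduced (A' v ++ [m]) := fun v =>
    IsReduced.of_append (p := []) (s := m' :: B' v) (by simpa using a1 v)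
  have hr2 : ∀ v, IsReduced (A' v ++ [m, m']) := fun v =>
    IsReduced.of_append (p := []) (s := B' v) (by simpa using a1 v)
  have hz1 : ∀ v, ZG H (TypeIN G v) (TypeOUT G v) (A' v ++ [m]) := fun v =>
    ZG.of_append (s := m' :: B' v) (by simpa using hzg v)
  have hz2 : ∀ v, ZG H (TypeIN G v) (TypeOUT G v) (A' v ++ [m, m']) := fun v =>
    ZG.of_append (s := B' v) (by simpa using hzg v)
  have hh1 : ∀ v, (A' v ++ [m]).head? = some (α v) := by
    intro v; rw [← a2 v]; cases A' v <;> simp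
  have hh2 : ∀ v, (A' v ++ [m, m']).head? = some (α v) := by
    intro v; rw [← a2 v]; cases A' v <;> simp
  have hg2 : ∀ v, gam (A' v ++ [m, m']) = gam (A' v ++ [m]) * edge m m' := by
    intro v; rw [gam_append]; simp
  have hco : ∀ u v, G.UAdj u v → gam (A' v ++ [m]) = edge (α v) (α u) * gam (A' u ++ [m]) := by
    intro u v huv
    rw [a3, a3, hgp, hgp, ← hpot u v huv]
    simp [mul_assoc]
  have hpar : ∀ u v, G.UAdj u v → (Even (A' u).length ↔ ¬ Even (A' v).length) := by
    intro u v huv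
    have hαuv : α v ≠ α u := fun e => by
      have := hα.uadj huv
      rw [e] at this
      exact hH _ (this.elim id id)
    obtain ⟨t, ht⟩ : ∃ t, A' u ++ [m] = α u :: t := by
      have := hh1 u
      cases hr : A' u ++ [m] with
      | nil => simp at hr
      | cons x t => rw [hr] at this; simp at this; exact ⟨t, by rw [this]⟩
    have : A' v ++ [m] = rcons (α v) (α u :: t) := by
      refine (hr1 v).eq_of_gam (isReduced_rcons _ (ht ▸ hr1 u)) (by rw [hh1, head?_rcons]) ?_
      rw [hco u v huv, gam_rcons, ht]
    have h2 := length_rcons (α v) (α u) t hαuv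
    rw [← this, ← ht] at h2
    simp only [List.length_append, List.length_singleton, Nat.even_add_one, Nat.odd_add_one,
      Nat.not_odd_iff_even] at h2
    exact h2.symm
  set S : V → List X := fun v => if Even (A' v).length then A' v ++ [m] else A' v ++ [m, m'] with hS
  set κ : V → X := fun v => if Even (A' v).length then m else m' with hκ
  have hgS : ∀ v, gam (S v) = gam (A' v ++ [m]) * edge m (κ v) := by
    intro v
    simp only [hS, hκ]
    split_ifs
    · simp
    · rw [hg2]
  have hκe : ∀ u v, edge m (κ u) * edge (κ u) (κ v) = edge m (κ v) := by
    intro u v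
    simp only [hκ]
    split_ifs <;> simp
  refine ⟨m, m', κ, _, MR.of_system hG hH (f := fun v => edge m (κ v))
    (fun u v _ => hκe u v) _ α S hα ?_ ?_ ?_ ?_ ?_ ?_ rfl, ?_⟩
  · intro v; simp only [hS]; split_ifs
    exacts [hr1 v, hr2 v]
  · intro v; simp only [hS]; split_ifs
    exacts [hh1 v, hh2 v]
  · intro v; simp only [hS, hκ]; split_ifs <;> simp
  · intro v; simp only [hS]; split_ifs with h
    · simpa [Nat.odd_add_one] using h
    · simpa [Nat.odd_add_one] using h
  · intro v; simp only [hS]; split_ifs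
    exacts [hz1 v, hz2 v]
  · intro u v huv
    rw [hgS, hgS, hco u v huv, ← hκe u v]
    simp only [mul_assoc]
  · intro v; simp only [hκ]; split_ifs <;> simp

end

/-! ### Reconfiguring a two-colored homomorphism -/

lemma ZG.snoc {H : Dgraph X} {i o : Prop} {x h : X} : ∀ {l : List X}, ZG H i o l →
    l.getLast? = some x → Odd l.length → (i → H.Adj h x) → (o → H.Adj x h) → ZG H i o (l ++ [h])
  | [], _, hx, _, _, _ => by simp at hx
  | [y], _, hx, _, hi, ho => by
    simp only [List.getLast?_singleton, Option.some.injEq] at hx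
    subst hx
    exact ⟨⟨hi, ho⟩, trivial⟩
  | [_, _], _, _, hl, _, _ => by simp [Nat.odd_iff] at hl
  | a :: b :: c :: t, hz, hx, hl, hi, ho =>
    ⟨hz.1, hz.2.1, ZG.snoc (l := c :: t) hz.2.2 (by simpa using hx)
      (by simpa [Nat.odd_add_one] using hl) hi ho⟩

section

variable {G : Dgraph V} {H : Dgraph X} {κ : V → X}

lemma type_of_walk (hG : ∀ v, ¬ TypeSYM G v) {q : V} {x h : X} (hκ : ∀ v, κ v = x ∨ κ v = h)
    (hne : ∀ u v, G.UAdj u v → κ u ≠ κ v) :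
    ∀ (l : List V) (u v : V), IsWalk G u v l →
      ((κ u = x → (TypeIN G u → TypeIN G q) ∧ (TypeOUT G u → TypeOUT G q)) ∧
        (κ u = h → (TypeIN G u → TypeOUT G q) ∧ (TypeOUT G u → TypeIN G q))) →
      ((κ v = x → (TypeIN G v → TypeIN G q) ∧ (TypeOUT G v → TypeOUT G q)) ∧
        (κ v = h → (TypeIN G v → TypeOUT G q) ∧ (TypeOUT G v → TypeIN G q)))
  | [], _, _, hw, _ => absurd rfl hw.1
  | [a], u, v, hw, hu => by
    obtain ⟨-, h1, h2, -⟩ := hw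
    simp only [List.head?_cons, List.getLast?_singleton, Option.some.injEq] at h1 h2
    rwa [← h2, h1]
  | a :: b :: t, u, v, hw, hu => by
    obtain ⟨-, h1, h2, h3⟩ := hw
    simp only [List.head?_cons, Option.some.injEq] at h1
    subst h1
    have h3 := List.isChain_cons_cons.1 h3
    refine type_of_walk hG hκ hne (b :: t) b v ⟨by simp, rfl, by simpa using h2, h3.2⟩ ?_
    have hab := hne a b h3.1
    have hsa := hG a
    have hsb := hG b
    have hx : κ b = x → κ a = h := fun e => (hκ a).resolve_left fun e' => hab (e'.trans e.symm)
    have hh : κ b = h → κ a = x := fun e => (hκ a).resolve_right fun e' => hab (e'.trans e.symm)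
    unfold TypeSYM at hsa hsb
    rcases h3.1 with e | e
    · have ta : TypeOUT G a := ⟨b, e⟩
      have tb : TypeIN G b := ⟨a, e⟩
      tauto
    · have ta : TypeIN G a := ⟨b, e⟩
      have tb : TypeOUT G b := ⟨a, e⟩
      tauto

lemma MR.of_zz [Fintype V] [Finite X] (hG : G.Loopless) (hH : H.Loopless) (hconn : G.WConn)
    (hnb : ∀ v, ∃ w, G.UAdj v w) (hκ : IsHom G H κ) {m m' : X} (hm : ∀ v, κ v = m ∨ κ v = m')
    {q : V} (hq : TypeSYM G q ∨ ∀ v, ¬ TypeSYM G v) {w : FreeGroup (X × X)}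
    (hw : ZZ H (TypeIN G q) (TypeOUT G q) (κ q) (κ q) w) : ∃ s, MR G H κ κ s ∧ s q = w := by
  classical
  have hne : ∀ u v, G.UAdj u v → κ u ≠ κ v := fun u v huv e => by
    have := hκ.uadj huv
    rw [e] at this
    exact hH _ (this.elim id id)
  obtain ⟨h, hh⟩ : ∃ h, ∀ v, κ v = κ q ∨ κ v = h := by
    rcases hm q with e | e
    · exact ⟨m', by rw [e]; exact hm⟩
    · exact ⟨m, by rw [e]; exact fun v => (hm v).symm⟩
  have hqh : κ q ≠ h := by
    obtain ⟨u, hu⟩ := hnb q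
    rw [← (hh u).resolve_left (hne q u hu).symm]
    exact hne q u hu
  have htype : ∀ v, (κ v = κ q → (TypeIN G v → TypeIN G q) ∧ (TypeOUT G v → TypeOUT G q)) ∧
      (κ v = h → (TypeIN G v → TypeOUT G q) ∧ (TypeOUT G v → TypeIN G q)) := by
    intro v
    rcases hq with hq | hq
    · have h1 := hq.1
      have h2 := hq.2
      tauto
    · obtain ⟨l, hl⟩ := hconn q v
      exact type_of_walk hq hh hne l q v hl ⟨fun _ => ⟨id, id⟩, fun e => absurd e hqh⟩
  obtain ⟨L, L1, L2, L3, L4, L5, L6⟩ := hw.exists_list hH (type_or_of_uadj hnb q)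
  have hS : ∀ v, ∃ S, IsReduced S ∧ S.head? = some (κ v) ∧ S.getLast? = some (κ v) ∧
      Odd S.length ∧ ZG H (TypeIN G v) (TypeOUT G v) S ∧
      gam S = edge (κ v) (κ q) * w * edge (κ q) (κ v) := by
    intro v
    rcases hh v with e | e
    · have ht := (htype v).1 e
      rw [e]
      exact ⟨L, L1, L2, L3, L4, L5.mono ht.1 ht.2, by simp [L6]⟩
    · have ht := (htype v).2 e
      have hi : TypeIN G v → H.Adj (κ q) h := by
        rintro ⟨u, hu⟩
        rw [← (hh u).resolve_right (by rw [← e]; exact hne u v (Or.inl hu)), ← e]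
        exact hκ hu
      have ho : TypeOUT G v → H.Adj h (κ q) := by
        rintro ⟨u, hu⟩
        rw [← (hh u).resolve_right (by rw [← e]; exact hne u v (Or.inr hu)), ← e]
        exact hκ hu
      obtain ⟨t, ht'⟩ : ∃ t, L ++ [h] = κ q :: t := by
        cases L with
        | nil => simp at L2
        | cons x t => simp at L2; exact ⟨t ++ [h], by rw [← L2]; rfl⟩
      have z1 : ZG H (TypeOUT G v) (TypeIN G v) (L ++ [h]) :=
        (L5.mono ht.2 ht.1).snoc L3 L4 ho hi
      have z2 : ZG H (TypeIN G v) (TypeOUT G v) (h :: (L ++ [h])) := by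
        rw [ht'] at z1 ⊢
        exact ⟨⟨hi, ho⟩, z1⟩
      have z3 := z2.zz (a := h) (b := h) rfl (by simp [List.getLast?_cons])
        (by simpa [Nat.odd_add_one, Nat.even_add_one] using L4)
      obtain ⟨S, s1, s2, s3, s4, s5, s6⟩ := z3.exists_list hH (type_or_of_uadj hnb v)
      rw [e]
      refine ⟨S, s1, s2, s3, s4, s5, ?_⟩
      obtain ⟨p, hp⟩ := List.getLast?_eq_some_iff.1 L3
      rw [s6, gam_cons_of_head h (y := κ q) (by rw [ht']; rfl), ← L6, hp, List.append_assoc,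
        List.singleton_append, gam_append]
      simp [mul_assoc]
  choose S s1 s2 s3 s4 s5 s6 using hS
  refine ⟨_, MR.of_system hG hH (f := fun v => edge (κ q) (κ v)) ?_ _ κ S hκ s1 s2 s3 s4 s5 ?_ rfl,
    ?_⟩
  · intro u v _
    rcases hh u with e | e <;> rcases hh v with e' | e' <;> rw [e, e'] <;> simp
  · intro u v _
    rw [s6, s6]
    rcases hh u with e | e <;> rcases hh v with e' | e' <;> rw [e, e'] <;> simp [mul_assoc]
  · simp [s6]

end

lemma exists_uadj [Fintype V] {G : Dgraph V} (hconn : G.WConn) (hcard : 1 < Fintype.card V)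
    (v : V) : ∃ w, G.UAdj v w := by
  have := Fintype.one_lt_card_iff_nontrivial.1 hcard
  obtain ⟨u, hu⟩ := exists_ne v
  obtain ⟨l, h0, h1, h2, h3⟩ := hconn v u
  rcases l with _ | ⟨a, _ | ⟨b, t⟩⟩
  · exact absurd rfl h0
  · simp only [List.head?_cons, List.getLast?_singleton, Option.some.injEq] at h1 h2
    exact absurd (h2.symm.trans h1) hu
  · simp only [List.head?_cons, Option.some.injEq] at h1
    exact ⟨b, h1 ▸ (List.isChain_cons_cons.1 h3).1⟩

end HRecoloring

open HRecoloring
/-- Classification of `H`-realizable walks for loopless digraphs: there is a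
vertex `q` such that the set `Π_q` of `H`-realizable walks is empty, a single
reduced walk, of the form `{RⁿP : n ∈ ℤ}`, or contains all reduced walks of
even length from `α q` to `β q` satisfying the zigzag condition for `q`. -/
theorem statement10 {V X : Type} [Fintype V] [Fintype X]
    (G : Dgraph V) (H : Dgraph X)
    (hGll : G.Loopless) (hHll : H.Loopless)
    (hGconn : G.WConn) (hGcard : 1 < Fintype.card V)
    (α β : V → X) (hα : IsHom G H α) (hβ : IsHom G H β) :
    ∃ q : V,
      MRealSet G H α β q = ∅ ∨
      (∃ Q : List X, MRealSet G H α β q = {Q}) ∨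
      (∃ R P : List X, IsWalk H (α q) (α q) R ∧ IsWalk H (α q) (β q) P ∧
        MRealSet G H α β q =
          {Q | IsReduced Q ∧ ∃ n : ℤ, PiEq (wcomp (zpowWalk R (α q) n) P) Q}) ∨
      {Q | IsWalk H (α q) (β q) Q ∧ IsReduced Q ∧ Even (wlen Q) ∧
        Zigzag G H q Q} ⊆ MRealSet G H α β q := by
  have hnb := exists_uadj hGconn hGcard
  obtain ⟨q, hq⟩ : ∃ q, TypeSYM G q ∨ ∀ v, ¬ TypeSYM G v := by
    by_cases h : ∃ q, TypeSYM G q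
    · exact h.imp fun _ => Or.inl
    · have : Nonempty V := Fintype.card_pos_iff.1 (by omega)
      exact ⟨Classical.arbitrary V, Or.inr fun v hv => h ⟨v, hv⟩⟩
  refine ⟨q, ?_⟩
  by_cases hcyc : ∃ r, closedGroup hGll hα q = Subgroup.zpowers r
  · obtain ⟨r, hr⟩ := hcyc
    exact (mRealSet_of_cyclic hGll hHll hnb hα hr).imp_right fun h => Or.inr (Or.inl h)
  have hC : ∀ C, IsWalk G q q C → gam (C.map α) = 1 := by
    by_contra! h
    obtain ⟨C, hC, hne⟩ := h
    exact hcyc (closedGroup_cyclic_of_walk hGll hα hC hne)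
  obtain ⟨y, hy, hne⟩ : ∃ y ∈ closedGroup hGll hα q, y ≠ 1 := by
    by_contra! h
    refine hcyc ⟨1, ?_⟩
    rwa [Subgroup.zpowers_one_eq_bot, Subgroup.eq_bot_iff_forall]
  by_cases he : ∃ s, MR G H α β s
  · obtain ⟨p, hp⟩ := he
    obtain ⟨m, m', κ, k, hk, hm⟩ := exists_twoColor hGll hHll hGconn hnb hα hC hy hne
    refine Or.inr (Or.inr (Or.inr ?_))
    rintro Q ⟨⟨hQ0, hQ1, hQ2, -⟩, hQ, heven, hz⟩
    rw [mem_mRealSet hGll hHll hnb]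
    have hodd : Odd Q.length := by
      have h1 := List.length_pos_iff.2 hQ0
      unfold wlen at heven
      obtain ⟨c, hc⟩ := heven
      exact ⟨c, by omega⟩
    have z1 := ((ZG_iff H Q _ _).2 hz).zz hQ1 hQ2 hodd
    have z := (hk.zz hGll q).symm.trans
      ((z1.trans (hp.zz hGll q).symm).trans (hk.zz hGll q))
    obtain ⟨t, ht, htq⟩ := MR.of_zz hGll hHll hGconn hnb (hk.symm hGll).isHom_left hm hq z
    refine ⟨hQ, hQ1, _, ((hk.trans ht).trans (hk.symm hGll)).trans hp, ?_⟩
    simp [htq, mul_assoc]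
  · left
    ext Q
    rw [mem_mRealSet hGll hHll hnb]
    simp only [Set.mem_empty_iff_false, iff_false]
    rintro ⟨-, -, s, hs, -⟩
    exact he ⟨s, hs⟩
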